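/- arXiv:1504.01903 — 6 statements merged into one kernel-verified Lean document; each statement's English description precedes it below -/
import Mathlib

section
/- Let g₁, g₂ : ℝⁿ → (−∞,+∞] be proper lower semicontinuous functions whose horizon functions are proper. If g₁ is convex and g₂ satisfies condition (w) with some base point w̄ ∈ dom g₁ ∩ dom g₂, then (g₁ + g₂)^∞ = g₁^∞ + g₂^∞, and g₁ + g₂ satisfies condition (w) with the same base point w̄. -/
open Filter MeasureTheory Metric Set
open scoped Topology ENNReal

noncomputable section

/-- Horizon function: g^∞(w) = lim_{δ↓0} inf{ λ g(w'/λ) : 0<λ<δ, |w'-w| ≤ δ }. -/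
def hor {E : Type*} [SeminormedAddCommGroup E] [NormedSpace ℝ E] (g : E → EReal) (w : E) : EReal :=
  ⨆ (δ : ℝ) (_ : 0 < δ), ⨅ (l : ℝ) (_ : l ∈ Set.Ioo (0:ℝ) δ) (w' : E)
      (_ : w' ∈ Metric.closedBall w δ), (l : EReal) * g (l⁻¹ • w')

/-- g is proper: never −∞ and not identically +∞. -/
def ProperFn {E : Type*} (g : E → EReal) : Prop := (∀ x, g x ≠ ⊥) ∧ ∃ x, g x ≠ ⊤

/-- Condition (w) with base point w̄. -/
def CondW {E : Type*} [SeminormedAddCommGroup E] [NormedSpace ℝ E] (g : E → EReal) (wbar : E) :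
    Prop :=
  ∀ w, hor g w = Filter.liminf (fun α : ℝ => ((α⁻¹ : ℝ) : EReal) * g (α • w + wbar)) Filter.atTop

/-- Convexity for (−∞,+∞]-valued functions. -/
def EConvexOn {E : Type*} [AddCommGroup E] [Module ℝ E] (g : E → EReal) : Prop :=
  ∀ x y : E, ∀ a b : ℝ, 0 ≤ a → 0 ≤ b → a + b = 1 →
    g (a • x + b • y) ≤ (a : EReal) * g x + (b : EReal) * g y

/-- The horizon function as a lower limit along `(l, w') → (0⁺, w)`. -/
lemma hor_eq_liminf {E : Type*} [SeminormedAddCommGroup E] [NormedSpace ℝ E]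
    (g : E → EReal) (w : E) :
    hor g w = liminf (fun p : ℝ × E => (p.1 : EReal) * g (p.1⁻¹ • p.2)) (𝓝[>] (0 : ℝ) ×ˢ 𝓝 w) := by
  have hb : (𝓝[>] (0 : ℝ) ×ˢ 𝓝 w).HasBasis (fun δ : ℝ => 0 < δ)
      (fun δ => Ioo 0 δ ×ˢ closedBall w δ) := by
    refine (nhdsGT_basis (0 : ℝ)).prod_same_index nhds_basis_closedBall ?_
    intro i j hi hj
    exact ⟨min i j, lt_min hi hj, Ioo_subset_Ioo_right (min_le_left _ _),
      closedBall_subset_closedBall (min_le_right _ _)⟩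
  rw [hb.liminf_eq_iSup_iInf]
  simp only [hor, mem_prod, iInf_prod, iInf_and]
  refine iSup_congr fun δ => iSup_congr fun _ => iInf_congr fun l => ?_
  rw [iInf_comm]

/-- The horizon function is a lower bound for the growth rate along every ray. -/
lemma hor_le_liminf_ray {E : Type*} [SeminormedAddCommGroup E] [NormedSpace ℝ E]
    (g : E → EReal) (w x₀ : E) :
    hor g w ≤ liminf (fun α : ℝ => ((α⁻¹ : ℝ) : EReal) * g (α • w + x₀)) atTop := by
  have ht : Tendsto (fun α : ℝ => (α⁻¹, w + α⁻¹ • x₀)) atTop (𝓝[>] (0 : ℝ) ×ˢ 𝓝 w) := by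
    refine tendsto_inv_atTop_nhdsGT_zero.prodMk ?_
    simpa using tendsto_const_nhds.add ((tendsto_inv_atTop_zero (𝕜 := ℝ)).smul_const x₀)
  rw [hor_eq_liminf]
  refine (liminf_le_liminf_of_le ht).trans_eq ?_
  change liminf ((fun p : ℝ × E => (p.1 : EReal) * g (p.1⁻¹ • p.2)) ∘
    fun α : ℝ => (α⁻¹, w + α⁻¹ • x₀)) atTop = _
  refine liminf_congr ?_
  filter_upwards [eventually_gt_atTop 0] with α hα
  simp [smul_smul, hα.ne']

/-- The horizon function is superadditive in the function. -/
lemma hor_add_le {E : Type*} [SeminormedAddCommGroup E] [NormedSpace ℝ E]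
    (g₁ g₂ : E → EReal) (w : E) :
    hor g₁ w + hor g₂ w ≤ hor (fun x => g₁ x + g₂ x) w := by
  simp only [hor_eq_liminf]
  refine EReal.le_liminf_add.trans_eq (liminf_congr ?_)
  filter_upwards [tendsto_fst.eventually (eventually_mem_nhdsWithin (a := (0 : ℝ)))] with p hp
  exact (EReal.left_distrib_of_nonneg_of_ne_top (EReal.coe_nonneg.2 (le_of_lt hp))
    (EReal.coe_ne_top _) _ _).symm

/-- A lower semicontinuous convex function grows along rays at most at the rate given by its
horizon function. -/
lemma EConvexOn.le_add_mul_of_hor_eq {E : Type*} [SeminormedAddCommGroup E] [NormedSpace ℝ E]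
    {g : E → EReal} (hc : EConvexOn g) (hlsc : LowerSemicontinuous g) {x₀ w : E} {r h α : ℝ}
    (hr : g x₀ = r) (hh : hor g w = h) (hα : 0 < α) :
    g (α • w + x₀) ≤ ((r + α * h : ℝ) : EReal) := by
  by_contra! hlt
  obtain ⟨c, hc₁, hc₂⟩ := EReal.lt_iff_exists_real_btwn.1 hlt
  rw [EReal.coe_lt_coe_iff] at hc₁
  obtain ⟨M, hM₁, hM₂⟩ : ∃ M, h < M ∧ r + α * M < c := by
    obtain ⟨M, hM₁, hM₂⟩ := exists_between ((lt_div_iff₀' hα).2 (lt_sub_iff_add_lt'.2 hc₁))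
    exact ⟨M, hM₁, lt_sub_iff_add_lt'.1 ((lt_div_iff₀' hα).1 hM₂)⟩
  have hfr : ∃ᶠ p : ℝ × E in 𝓝[>] (0 : ℝ) ×ˢ 𝓝 w, (p.1 : EReal) * g (p.1⁻¹ • p.2) < M := by
    refine frequently_lt_of_liminf_lt (by isBoundedDefault) ?_
    rwa [← hor_eq_liminf, hh, EReal.coe_lt_coe_iff]
  have hfst : Tendsto (fun p : ℝ × E => p.1) (𝓝[>] (0 : ℝ) ×ˢ 𝓝 w) (𝓝 0) :=
    tendsto_nhds_of_tendsto_nhdsWithin tendsto_fst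
  have hcoef : Tendsto (fun p : ℝ × E => 1 - α * p.1) (𝓝[>] (0 : ℝ) ×ˢ 𝓝 w) (𝓝 1) := by
    simpa using (hfst.const_mul α).const_sub 1
  have hpt : Tendsto (fun p : ℝ × E => (1 - α * p.1) • x₀ + α • p.2)
      (𝓝[>] (0 : ℝ) ×ˢ 𝓝 w) (𝓝 (α • w + x₀)) := by
    simpa [add_comm] using (hcoef.smul_const x₀).add (tendsto_snd.const_smul α)
  have hbound : Tendsto (fun p : ℝ × E => (1 - α * p.1) * r + α * M)
      (𝓝[>] (0 : ℝ) ×ˢ 𝓝 w) (𝓝 (r + α * M)) := by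
    simpa using (hcoef.mul_const r).add_const (α * M)
  refine hM₂.not_ge (ge_of_tendsto_of_frequently hbound ?_)
  refine (hfr.and_eventually ((hpt.eventually (hlsc _ _ hc₂)).and
    ((hcoef.eventually (eventually_gt_nhds zero_lt_one)).and
      (tendsto_fst.eventually self_mem_nhdsWithin)))).mono ?_
  rintro ⟨l, w'⟩ ⟨hM, hcp, hpos, hl : 0 < l⟩
  dsimp only at hM hcp hpos ⊢
  have hseg := hc x₀ (l⁻¹ • w') (1 - α * l) (α * l) hpos.le (by positivity) (by ring)
  rw [smul_smul, mul_assoc, mul_inv_cancel₀ hl.ne', mul_one, hr, EReal.coe_mul α l,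
    mul_assoc] at hseg
  have hscaled : (α : EReal) * (l * g (l⁻¹ • w')) ≤ α * M :=
    mul_le_mul_of_nonneg_left hM.le (EReal.coe_nonneg.2 hα.le)
  have := (hcp.le.trans hseg).trans (add_le_add_right hscaled _)
  exact_mod_cast this

/-- Along rays from a point of its domain, adding a lower semicontinuous convex function increases
the lower growth rate by at most its horizon function. -/
lemma EConvexOn.liminf_ray_add_le {E : Type*} [SeminormedAddCommGroup E] [NormedSpace ℝ E]
    {g₁ g₂ : E → EReal} (hc : EConvexOn g₁) (hlsc : LowerSemicontinuous g₁) {x₀ w : E}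
    (hbot : g₁ x₀ ≠ ⊥) (htop : g₁ x₀ ≠ ⊤) (hhbot : hor g₁ w ≠ ⊥)
    (h₂ : liminf (fun α : ℝ => ((α⁻¹ : ℝ) : EReal) * g₂ (α • w + x₀)) atTop ≠ ⊥) :
    liminf (fun α : ℝ => ((α⁻¹ : ℝ) : EReal) * (g₁ (α • w + x₀) + g₂ (α • w + x₀))) atTop ≤
      hor g₁ w + liminf (fun α : ℝ => ((α⁻¹ : ℝ) : EReal) * g₂ (α • w + x₀)) atTop := by
  by_cases hhtop : hor g₁ w = ⊤
  · rw [hhtop, EReal.top_add_of_ne_bot h₂]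
    exact le_top
  lift g₁ x₀ to ℝ using ⟨htop, hbot⟩ with r hr
  lift hor g₁ w to ℝ using ⟨hhtop, hhbot⟩ with h hh
  have hlim : limsup (fun α : ℝ => ((α⁻¹ * r + h : ℝ) : EReal)) atTop = h := by
    refine Tendsto.limsup_eq (EReal.tendsto_coe.2 ?_)
    simpa using (tendsto_inv_atTop_zero.mul_const r).add_const h
  rw [← hlim]
  refine le_trans (liminf_le_liminf ?_) (EReal.liminf_add_le (.inl ?_) (.inl ?_))
  · filter_upwards [eventually_gt_atTop 0] with α hα
    have hα' : (0 : EReal) ≤ ((α⁻¹ : ℝ) : EReal) := EReal.coe_nonneg.2 (inv_nonneg.2 hα.le)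
    rw [EReal.left_distrib_of_nonneg_of_ne_top hα' (EReal.coe_ne_top _), Pi.add_apply]
    gcongr
    refine (mul_le_mul_of_nonneg_left
      (hc.le_add_mul_of_hor_eq hlsc hr.symm hh.symm hα) hα').trans_eq ?_
    rw [← EReal.coe_mul, mul_add, inv_mul_cancel_left₀ hα.ne']
  · simp only [hlim, ne_eq, EReal.coe_ne_bot, not_false_eq_true]
  · simp only [hlim, ne_eq, EReal.coe_ne_top, not_false_eq_true]

/-- additivity of horizon functions when g₁ is convex and g₂ satisfies
condition (w) with a base point in dom g₁ ∩ dom g₂. -/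
theorem horizon_sum_eq {n : ℕ} (g₁ g₂ : (Fin n → ℝ) → EReal)
    (h₁lsc : LowerSemicontinuous g₁) (h₂lsc : LowerSemicontinuous g₂)
    (h₁p : ProperFn g₁) (h₂p : ProperFn g₂)
    (h₁hp : ProperFn (hor g₁)) (h₂hp : ProperFn (hor g₂))
    (h₁cvx : EConvexOn g₁)
    (wbar : Fin n → ℝ) (hdom₁ : g₁ wbar ≠ ⊤) (hdom₂ : g₂ wbar ≠ ⊤)
    (h₂w : CondW g₂ wbar) :
    (∀ w, hor (fun x => g₁ x + g₂ x) w = hor g₁ w + hor g₂ w) ∧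
      CondW (fun x => g₁ x + g₂ x) wbar := by
  have key : ∀ w, liminf (fun α : ℝ => ((α⁻¹ : ℝ) : EReal) *
      (g₁ (α • w + wbar) + g₂ (α • w + wbar))) atTop ≤ hor g₁ w + hor g₂ w := by
    intro w
    rw [h₂w w]
    exact h₁cvx.liminf_ray_add_le h₁lsc (h₁p.1 _) hdom₁ (h₁hp.1 w) (h₂w w ▸ h₂hp.1 w)
  have lower := fun w => hor_add_le g₁ g₂ w
  have upper := fun w => hor_le_liminf_ray (fun x => g₁ x + g₂ x) w wbar
  exact ⟨fun w => ((upper w).trans (key w)).antisymm (lower w),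
    fun w => (upper w).antisymm ((key w).trans (lower w))⟩

end
end

section
/- Let g : ℝ → (−∞,+∞] be a proper lower semicontinuous function and let w > 0. Then g^∞(w) = (g + δ_{ℝ₊})^∞(w), where δ_{ℝ₊} is the indicator function of [0,∞), and consequently g^∞(w) = w · liminf_{α→+∞} g(α)/α. -/
open Filter MeasureTheory Metric Set
open scoped Topology ENNReal

noncomputable section

theorem hor_mono {E : Type*} [SeminormedAddCommGroup E] [NormedSpace ℝ E] {g h : E → EReal}
    (hgh : ∀ x, g x ≤ h x) (w : E) : hor g w ≤ hor h w := by
  unfold hor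
  refine iSup₂_mono fun δ _ => iInf₂_mono fun l hl => iInf₂_mono fun w' _ => ?_
  exact mul_le_mul_of_nonneg_left (hgh _) (EReal.coe_nonneg.2 hl.1.le)

theorem hor_add_indicator_Ici_le (g : ℝ → EReal) {w : ℝ} (hw : 0 < w) :
    hor (fun x => g x + (if x ∈ Set.Ici (0:ℝ) then (0:EReal) else ⊤)) w ≤ hor g w := by
  refine iSup₂_le fun δ hδ => le_iSup₂_of_le (min δ w) (lt_min hδ hw) ?_
  refine le_iInf₂ fun l hl => le_iInf₂ fun w' hw' => ?_
  rw [Metric.mem_closedBall, Real.dist_eq] at hw'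
  have hw'0 : 0 ≤ w' := by
    have := abs_le.1 (hw'.trans (min_le_right _ _))
    linarith
  refine iInf₂_le_of_le l ⟨hl.1, hl.2.trans_le (min_le_left _ _)⟩
    (iInf₂_le_of_le w' ?_ ?_)
  · rw [Metric.mem_closedBall, Real.dist_eq]
    exact hw'.trans (min_le_left _ _)
  · have : l⁻¹ • w' ∈ Set.Ici (0:ℝ) := smul_nonneg (inv_nonneg.2 hl.1.le) hw'0
    simp only [if_pos this, add_zero, le_refl]

theorem hor_le_mul_liminf (g : ℝ → EReal) {w : ℝ} (hw : 0 < w) :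
    hor g w ≤ (w : EReal) * liminf (fun α : ℝ => ((α⁻¹ : ℝ) : EReal) * g α) atTop := by
  refine iSup₂_le fun δ hδ => ?_
  set m : EReal := ⨅ (l : ℝ) (_ : l ∈ Set.Ioo (0:ℝ) δ) (w' : ℝ)
      (_ : w' ∈ Metric.closedBall w δ), (l : EReal) * g (l⁻¹ • w')
  have hcancel : m = (w : EReal) * (((w⁻¹ : ℝ) : EReal) * m) := by
    rw [← mul_assoc, ← EReal.coe_mul, mul_inv_cancel₀ hw.ne', EReal.coe_one, one_mul]
  rw [hcancel]
  refine mul_le_mul_of_nonneg_left ?_ (EReal.coe_nonneg.2 hw.le)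
  refine le_liminf_of_le (by isBoundedDefault) ?_
  filter_upwards [eventually_gt_atTop (w / δ)] with α hα
  have hα0 : 0 < α := (div_pos hw hδ).trans hα
  have hm : m ≤ ((w / α : ℝ) : EReal) * g α := by
    refine iInf₂_le_of_le (w / α) ⟨div_pos hw hα0, ?_⟩
      (iInf₂_le_of_le w (Metric.mem_closedBall_self hδ.le) ?_)
    · rw [div_lt_iff₀ hδ] at hα
      rw [div_lt_iff₀ hα0]
      linarith
    · have : (w / α)⁻¹ • w = α := by
        rw [smul_eq_mul]
        field_simp
      rw [this]
  calc ((w⁻¹ : ℝ) : EReal) * m ≤ ((w⁻¹ : ℝ) : EReal) * (((w / α : ℝ) : EReal) * g α) :=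
        mul_le_mul_of_nonneg_left hm (EReal.coe_nonneg.2 (inv_nonneg.2 hw.le))
    _ = ((α⁻¹ : ℝ) : EReal) * g α := by
        rw [← mul_assoc, ← EReal.coe_mul]
        congr 2
        field_simp

theorem mul_liminf_le_hor (g : ℝ → EReal) {w : ℝ} (hw : 0 < w) :
    (w : EReal) * liminf (fun α : ℝ => ((α⁻¹ : ℝ) : EReal) * g α) atTop ≤ hor g w := by
  refine EReal.ge_of_forall_gt_iff_ge.1 fun d hd => ?_
  have hdw : ((d / w : ℝ) : EReal) <
      liminf (fun α : ℝ => ((α⁻¹ : ℝ) : EReal) * g α) atTop := by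
    by_contra! h
    refine hd.not_ge ((mul_le_mul_of_nonneg_left h (EReal.coe_nonneg.2 hw.le)).trans_eq ?_)
    rw [← EReal.coe_mul, mul_div_cancel₀ _ hw.ne']
  obtain ⟨c, hdc, hcL⟩ := EReal.lt_iff_exists_real_btwn.1 hdw
  have hdc' : d < w * c := by
    rw [EReal.coe_lt_coe_iff, div_lt_iff₀ hw] at hdc
    linarith
  obtain ⟨A, hA⟩ := eventually_atTop.1 (eventually_lt_of_lt_liminf hcL)
  have hA0 : 0 < max A 1 := lt_max_of_lt_right one_pos
  have hcont : ∀ᶠ x in 𝓝 w, d < x * c :=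
    (continuous_id.mul continuous_const).continuousAt.eventually_const_lt hdc'
  obtain ⟨ε, hε, hball⟩ := Metric.nhds_basis_closedBall.eventually_iff.1 hcont
  set δ : ℝ := min ε (min (w / 2) (w / 2 / max A 1))
  have hδ : 0 < δ := by positivity
  refine le_iSup₂_of_le δ hδ (le_iInf₂ fun l hl => le_iInf₂ fun w' hw' => ?_)
  have hdc_w' : d < w' * c :=
    hball (Metric.closedBall_subset_closedBall (min_le_left _ _) hw')
  have hw2 : w / 2 ≤ w' := by
    rw [Metric.mem_closedBall, Real.dist_eq] at hw'
    have := abs_le.1 (hw'.trans ((min_le_right _ _).trans (min_le_left _ _)))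
    linarith
  have hw'0 : 0 < w' := by linarith
  have hl0 : 0 < l := hl.1
  have hAl : max A 1 ≤ l⁻¹ • w' := by
    have h := hl.2.trans_le ((min_le_right _ _).trans (min_le_right _ _))
    rw [lt_div_iff₀ hA0] at h
    rw [smul_eq_mul, inv_mul_eq_div, le_div_iff₀ hl0]
    linarith
  have hc := (hA _ ((le_max_left _ _).trans hAl)).le
  calc (d : EReal) ≤ ((w' * c : ℝ) : EReal) := EReal.coe_le_coe_iff.2 hdc_w'.le
    _ = (w' : EReal) * (c : EReal) := EReal.coe_mul _ _
    _ ≤ (w' : EReal) * ((((l⁻¹ • w')⁻¹ : ℝ) : EReal) * g (l⁻¹ • w')) :=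
        mul_le_mul_of_nonneg_left hc (EReal.coe_nonneg.2 hw'0.le)
    _ = (l : EReal) * g (l⁻¹ • w') := by
        rw [← mul_assoc, ← EReal.coe_mul]
        congr 2
        rw [smul_eq_mul]
        field_simp

/-- for a proper lsc function on ℝ and w > 0,
g^∞(w) = (g + δ_{ℝ₊})^∞(w) = w ⋅ liminf_{α→∞} g(α)/α. -/
theorem horizon_pos_ray (g : ℝ → EReal)
    (hlsc : LowerSemicontinuous g) (hp : ProperFn g)
    (w : ℝ) (hw : 0 < w) :
    hor g w = hor (fun x => g x + (if x ∈ Set.Ici (0:ℝ) then (0:EReal) else ⊤)) w ∧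
      hor g w =
        (w : EReal) * Filter.liminf (fun α : ℝ => ((α⁻¹ : ℝ) : EReal) * g α) Filter.atTop := by
  refine ⟨le_antisymm (hor_mono (fun x => ?_) w) (hor_add_indicator_Ici_le g hw),
    le_antisymm (hor_le_mul_liminf g hw) (mul_liminf_le_hor g hw)⟩
  split_ifs
  · rw [add_zero]
  · rw [EReal.add_top_of_ne_bot (hp.1 x)]
    exact le_top

end
end

section
/- Let g : ℝⁿ → (−∞,+∞] be a proper lower semicontinuous function. Define ĝ : ℝ × ℝⁿ → (−∞,+∞] by ĝ(λ,x) = λ·g(x/λ) for λ > 0, ĝ(0,x) = g^∞(x), and ĝ(λ,x) = +∞ for λ < 0. Then ĝ is lower semicontinuous on ℝ^{1+n}, and for every x̄ ∈ ℝⁿ one has g^∞(x̄) = lim_{δ↓0} inf{ ĝ(λ,x) : 0 ≤ λ ≤ δ, |x − x̄| ≤ δ }. -/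
open Filter MeasureTheory Metric Set
open scoped Topology ENNReal

noncomputable section

/-- The lsc extension ĝ(λ,x): λ g(x/λ) for λ>0, g^∞(x) at λ=0, +∞ for λ<0. -/
def ghat {n : ℕ} (g : (Fin n → ℝ) → EReal) (p : ℝ × (Fin n → ℝ)) : EReal :=
  if 0 < p.1 then (p.1 : EReal) * g (p.1⁻¹ • p.2)
  else if p.1 = 0 then hor g p.2
  else ⊤

lemma exists_lt_iInf_of_lt_hor {E : Type*} [SeminormedAddCommGroup E] [NormedSpace ℝ E]
    {g : E → EReal} {w : E} {y : EReal} (h : y < hor g w) :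
    ∃ δ : ℝ, 0 < δ ∧ y < ⨅ (l : ℝ) (_ : l ∈ Set.Ioo (0:ℝ) δ) (w' : E)
      (_ : w' ∈ Metric.closedBall w δ), (l : EReal) * g (l⁻¹ • w') := by
  simpa only [hor, lt_iSup_iff, exists_prop] using h

lemma lowerSemicontinuous_hor {E : Type*} [SeminormedAddCommGroup E] [NormedSpace ℝ E]
    (g : E → EReal) : LowerSemicontinuous (hor g) := by
  intro w y hy
  obtain ⟨δ, hδ, h⟩ := exists_lt_iInf_of_lt_hor hy
  filter_upwards [Metric.ball_mem_nhds w (half_pos hδ)] with w' hw'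
  refine h.trans_le (le_trans ?_ (le_iSup₂ (δ / 2) (half_pos hδ)))
  refine le_iInf₂ fun l hl => le_iInf₂ fun v hv => ?_
  refine iInf₂_le_of_le l ⟨hl.1, by linarith [hl.2]⟩ (iInf₂_le v ?_)
  rw [Metric.mem_ball] at hw'
  rw [Metric.mem_closedBall] at hv ⊢
  linarith [dist_triangle v w' w]

lemma eventually_lt_perspective {E : Type*} [SeminormedAddCommGroup E] [NormedSpace ℝ E]
    {g : E → EReal} (hlsc : LowerSemicontinuous g) {p : ℝ × E} (hp : 0 < p.1) {y : EReal}
    (hy : y < (p.1 : EReal) * g (p.1⁻¹ • p.2)) :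
    ∀ᶠ q in 𝓝 p, y < (q.1 : EReal) * g (q.1⁻¹ • q.2) := by
  rw [mul_comm, ← EReal.div_lt_iff (EReal.coe_pos.2 hp) (EReal.coe_ne_top _),
    EReal.lt_iff_exists_real_btwn] at hy
  obtain ⟨z, hyz, hz⟩ := hy
  rw [EReal.div_lt_iff (EReal.coe_pos.2 hp) (EReal.coe_ne_top _), ← EReal.coe_mul] at hyz
  have hcont : ContinuousAt (fun q : ℝ × E => q.1⁻¹ • q.2) p :=
    (continuousAt_fst.inv₀ hp.ne').smul continuousAt_snd
  have hmul : Continuous fun q : ℝ × E => ((z * q.1 : ℝ) : EReal) :=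
    continuous_coe_real_ereal.comp (by fun_prop)
  filter_upwards [hcont.eventually (hlsc _ _ hz), hmul.continuousAt.eventually_const_lt hyz,
    continuousAt_fst.eventually_const_lt hp] with q hgq hyq hq
  rw [EReal.coe_mul] at hyq
  rw [mul_comm]
  exact hyq.trans_le (mul_le_mul_of_nonneg_right hgq.le (EReal.coe_nonneg.2 hq.le))

lemma ghat_of_pos {n : ℕ} (g : (Fin n → ℝ) → EReal) {p : ℝ × (Fin n → ℝ)} (hp : 0 < p.1) :
    ghat g p = (p.1 : EReal) * g (p.1⁻¹ • p.2) :=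
  if_pos hp

lemma ghat_of_eq_zero {n : ℕ} (g : (Fin n → ℝ) → EReal) {p : ℝ × (Fin n → ℝ)} (hp : p.1 = 0) :
    ghat g p = hor g p.2 := by
  simp [ghat, hp]

lemma ghat_of_neg {n : ℕ} (g : (Fin n → ℝ) → EReal) {p : ℝ × (Fin n → ℝ)} (hp : p.1 < 0) :
    ghat g p = ⊤ := by
  simp [ghat, hp.not_gt, hp.ne]

lemma lowerSemicontinuous_ghat {n : ℕ} {g : (Fin n → ℝ) → EReal}
    (hlsc : LowerSemicontinuous g) : LowerSemicontinuous (ghat g) := by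
  intro p y hy
  rcases lt_trichotomy p.1 0 with hp | hp | hp
  · filter_upwards [continuousAt_fst.eventually_lt_const hp] with q hq
    rw [ghat_of_neg g hq]
    exact hy.trans_le le_top
  · rw [ghat_of_eq_zero g hp] at hy
    obtain ⟨δ, hδ, h⟩ := exists_lt_iInf_of_lt_hor hy
    filter_upwards [continuousAt_fst.eventually_lt_const (hp.trans_lt hδ),
      continuousAt_snd.eventually (Metric.closedBall_mem_nhds p.2 hδ),
      continuousAt_snd.eventually (lowerSemicontinuous_hor g p.2 y hy)] with q hq hball hhor
    rcases lt_trichotomy q.1 0 with hq0 | hq0 | hq0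
    · rw [ghat_of_neg g hq0]
      exact hy.trans_le le_top
    · rwa [ghat_of_eq_zero g hq0]
    · rw [ghat_of_pos g hq0]
      exact h.trans_le (iInf₂_le_of_le q.1 ⟨hq0, hq⟩ (iInf₂_le q.2 hball))
  · rw [ghat_of_pos g hp] at hy
    filter_upwards [eventually_lt_perspective hlsc hp hy,
      continuousAt_fst.eventually_const_lt hp] with q hyq hq
    rwa [ghat_of_pos g hq]

/-- ĝ is lower semicontinuous on ℝ^{1+n} and the horizon function of g
can be recovered from ĝ. -/
theorem ghat_lsc_and_horizon {n : ℕ} (g : (Fin n → ℝ) → EReal)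
    (hlsc : LowerSemicontinuous g) (hp : ProperFn g) :
    LowerSemicontinuous (ghat g) ∧
      ∀ xbar : Fin n → ℝ,
        hor g xbar =
          ⨆ (δ : ℝ) (_ : 0 < δ), ⨅ (l : ℝ) (_ : l ∈ Set.Icc (0:ℝ) δ) (x : Fin n → ℝ)
            (_ : x ∈ Metric.closedBall xbar δ), ghat g (l, x) := by
  refine ⟨lowerSemicontinuous_ghat hlsc, fun xbar => le_antisymm ?_ ?_⟩
  · refine le_of_forall_lt fun y hy => ?_
    obtain ⟨z, hyz, hz⟩ := exists_between hy
    rw [← ghat_of_eq_zero g (p := ((0 : ℝ), xbar)) rfl] at hz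
    obtain ⟨δ, hδ, h⟩ := Metric.nhds_basis_closedBall.eventually_iff.1
      (lowerSemicontinuous_ghat hlsc _ _ hz)
    refine hyz.trans_le (le_trans ?_ (le_iSup₂ δ hδ))
    refine le_iInf₂ fun l hl => le_iInf₂ fun x hx => (h ?_).le
    rw [← closedBall_prod_same, Set.mem_prod, Metric.mem_closedBall, Real.dist_eq, sub_zero,
      abs_of_nonneg hl.1]
    exact ⟨hl.2, hx⟩
  · refine iSup₂_mono fun δ _ => le_iInf₂ fun l hl => le_iInf₂ fun x hx => ?_
    refine iInf₂_le_of_le l (Set.Ioo_subset_Icc_self hl) (iInf₂_le_of_le x hx ?_)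
    rw [ghat_of_pos g hl.1]

end
end

section
/- Let (Ω, G, P) be a complete probability space and let H be a G-normal integrand on ℝ^{m+k} × Ω with H(u,v,ω) ≥ m₀(ω) for some integrable m₀, and suppose H^∞((0,v),ω) > 0 for every v ∈ ℝ^k \ {0} and every ω. Then: (i) the function p(u,ω) := inf_{v ∈ ℝ^k} H(u,v,ω) is a G-normal integrand on ℝ^m × Ω and the infimum is attained for every (u,ω); (ii) p^∞(u,ω) = inf_{v ∈ ℝ^k} H^∞((u,v),ω) for every (u,ω); (iii) for every G-measurable map x : Ω → ℝ^m there exists a G-measurable map v̄ : Ω → ℝ^k such that p(x(ω),ω) = H(x(ω), v̄(ω), ω) for every ω. -/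
open Filter MeasureTheory Metric Set
open scoped Topology ENNReal

noncomputable section

theorem isCompact_setOf_forall_le_nat (n : ℕ → ℕ) : IsCompact {x : ℕ → ℕ | ∀ i, x i ≤ n i} := by
  convert isCompact_univ_pi fun i => (Set.finite_Iic (n i)).isCompact using 1
  ext y
  simp [Pi.le_def]

theorem exists_subset_of_forall_le_of_isOpen (n : ℕ → ℕ) {V : Set (ℕ → ℕ)} (hV : IsOpen V)
    (hKV : {x : ℕ → ℕ | ∀ i, x i ≤ n i} ⊆ V) :
    ∃ j, {x : ℕ → ℕ | ∀ i < j, x i ≤ n i} ⊆ V := by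
  by_contra! hcon
  have hex : ∀ j, ∃ x : ℕ → ℕ, (∀ i < j, x i ≤ n i) ∧ x ∉ V := fun j => by
    obtain ⟨x, hx, hxV⟩ := Set.not_subset.1 (hcon j)
    exact ⟨x, hx, hxV⟩
  choose x hx hxV using hex
  obtain ⟨y, hyK, φ, hφ, hy⟩ := (isCompact_setOf_forall_le_nat n).tendsto_subseq
    (x := fun j i => min (x j i) (n i)) fun j i => min_le_right _ _
  have hxy : Tendsto (x ∘ φ) atTop (𝓝 y) := by
    rw [tendsto_pi_nhds] at hy ⊢
    intro i
    refine (hy i).congr' ?_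
    filter_upwards [eventually_gt_atTop i] with j hj
    exact min_eq_left (hx _ i (hj.trans_le (hφ.id_le j)))
  obtain ⟨j, hj⟩ := (hxy.eventually (hV.mem_nhds (hKV hyK))).exists
  exact hxV _ hj

theorem exists_isCompact_subset_range_le_measure {α : Type*} [TopologicalSpace α]
    [MeasurableSpace α] (μ : Measure α) [μ.OuterRegular] {f : (ℕ → ℕ) → α} (hf : Continuous f)
    {c : ℝ≥0∞} (hc : c < μ (range f)) : ∃ K ⊆ range f, IsCompact K ∧ c ≤ μ K := by
  have step : ∀ (j : ℕ) (S : Set (ℕ → ℕ)), ∃ m : ℕ,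
      c < μ (f '' S) → c < μ (f '' (S ∩ {x | x j ≤ m})) := by
    intro j S
    by_cases hS : c < μ (f '' S)
    · have hU : f '' S = ⋃ m : ℕ, f '' (S ∩ {x | x j ≤ m}) := by
        rw [← image_iUnion, ← inter_iUnion]
        congr 1
        ext x
        simp only [mem_inter_iff, mem_iUnion, mem_ofPred_eq, iff_self_and]
        exact fun _ => ⟨x j, le_rfl⟩
      have hmono : Monotone fun m : ℕ => f '' (S ∩ {x | x j ≤ m}) := fun a b hab =>
        image_mono (inter_subset_inter_right _ fun x hx => le_trans hx hab)
      rw [hU, hmono.measure_iUnion, lt_iSup_iff] at hS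
      obtain ⟨m, hm⟩ := hS
      exact ⟨m, fun _ => hm⟩
    · exact ⟨0, fun h => absurd h hS⟩
  choose m hm using step
  let T : ℕ → Set (ℕ → ℕ) := fun j => Nat.rec univ (fun j S => S ∩ {x | x j ≤ m j S}) j
  have hT : ∀ j, c < μ (f '' T j) := by
    intro j
    induction j with
    | zero => simpa [T] using hc
    | succ j ih => exact hm j _ ih
  let n : ℕ → ℕ := fun j => m j (T j)
  have hTn : ∀ j, T j ⊆ {x | ∀ i < j, x i ≤ n i} := by
    intro j
    induction j with
    | zero => intro x _ i hi; omega
    | succ j ih =>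
      rintro x ⟨hx, hxj⟩ i hi
      rcases Nat.lt_succ_iff_lt_or_eq.1 hi with hi | rfl
      · exact ih hx i hi
      · exact hxj
  refine ⟨f '' {x | ∀ i, x i ≤ n i}, image_subset_range _ _,
    (isCompact_setOf_forall_le_nat n).image hf, ?_⟩
  by_contra! hlt
  obtain ⟨U, hKU, hU, hUc⟩ := Set.exists_isOpen_lt_of_lt _ _ hlt
  obtain ⟨j, hj⟩ := exists_subset_of_forall_le_of_isOpen n (hU.preimage hf)
    (image_subset_iff.1 hKU)
  exact absurd ((hT j).trans_le (measure_mono (image_subset_iff.2 ((hTn j).trans hj))))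
    hUc.not_gt

/-- Analytic sets are universally measurable. -/
theorem MeasureTheory.AnalyticSet.nullMeasurableSet {α : Type*} [TopologicalSpace α]
    [T2Space α] [MeasurableSpace α] [OpensMeasurableSpace α] {μ : Measure α} [IsFiniteMeasure μ]
    [μ.OuterRegular] {A : Set α} (hA : AnalyticSet A) : NullMeasurableSet A μ := by
  rw [AnalyticSet] at hA
  rcases hA with rfl | ⟨f, hf, rfl⟩
  · exact MeasurableSet.empty.nullMeasurableSet
  rcases eq_or_ne (μ (range f)) 0 with h0 | h0
  · exact NullMeasurableSet.of_null h0
  obtain ⟨u, -, hu, hlim⟩ := exists_seq_strictMono_tendsto' (pos_iff_ne_zero.2 h0)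
  choose K hKs hK hKu using fun n => exists_isCompact_subset_range_le_measure μ hf (hu n).2
  have hKm : MeasurableSet (⋃ n, K n) := MeasurableSet.iUnion fun n => (hK n).measurableSet
  have hle : μ (range f) ≤ μ (⋃ n, K n) :=
    le_of_tendsto' hlim fun n => (hKu n).trans (measure_mono (subset_iUnion K n))
  exact hKm.nullMeasurableSet.congr (ae_eq_of_subset_of_measure_ge (iUnion_subset hKs) hle
    hKm.nullMeasurableSet (measure_ne_top _ _))

/-- A measurable subset of `X × Ω` depends on `ω` only through countably many measurable sets. -/
theorem exists_measurableSet_preimage_prodMap_nat_bool {X Ω : Type*} [MeasurableSpace X]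
    [MeasurableSpace Ω] {S : Set (X × Ω)} (hS : MeasurableSet S) :
    ∃ f : Ω → ℕ → Bool, Measurable f ∧ ∃ S' : Set (X × (ℕ → Bool)), MeasurableSet S' ∧
      S = Prod.map id f ⁻¹' S' := by
  classical
  induction S, hS using MeasurableSpace.induction_on_inter generateFrom_prod.symm
    isPiSystem_prod with
  | empty => exact ⟨fun _ _ => false, measurable_const, ∅, MeasurableSet.empty, rfl⟩
  | basic t ht =>
    obtain ⟨A, hA, B, hB, rfl⟩ := ht
    refine ⟨fun ω _ => decide (ω ∈ B), measurable_pi_lambda _ fun _ => ?_,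
      A ×ˢ {b | b 0 = true}, hA.prod ?_, ?_⟩
    · exact measurable_to_bool (by simpa [preimage] using hB)
    · exact measurableSet_eq_fun (measurable_pi_apply 0) measurable_const
    · ext ⟨x, ω⟩
      simp
  | compl t _ ih =>
    obtain ⟨f, hf, S', hS', rfl⟩ := ih
    exact ⟨f, hf, S'ᶜ, hS'.compl, rfl⟩
  | iUnion s _ _ ih =>
    choose f hf S' hS' hs using ih
    refine ⟨fun ω j => f j.unpair.1 ω j.unpair.2, measurable_pi_lambda _ fun j =>
      (measurable_pi_apply _).comp (hf _),
      ⋃ n, Prod.map id (fun b i => b (Nat.pair n i)) ⁻¹' S' n, MeasurableSet.iUnion fun n => ?_, ?_⟩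
    · refine (measurable_id.prodMap (measurable_pi_lambda _ fun i => ?_)) (hS' n)
      exact measurable_pi_apply _
    · ext ⟨x, ω⟩
      simp [hs]

/-- Measurable projection theorem for complete finite measures. -/
theorem MeasurableSet.image_snd_of_isComplete {X Ω : Type*} [MeasurableSpace X]
    [StandardBorelSpace X] [MeasurableSpace Ω] (μ : Measure Ω) [IsFiniteMeasure μ]
    [μ.IsComplete] {S : Set (X × Ω)} (hS : MeasurableSet S) : MeasurableSet (Prod.snd '' S) := by
  obtain ⟨f, hf, S', hS', rfl⟩ := exists_measurableSet_preimage_prodMap_nat_bool hS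
  have hA : AnalyticSet (Prod.snd '' S') := hS'.analyticSet_image measurable_snd
  have h := (hA.nullMeasurableSet (μ := μ.map f)).preimage
    (hf.quasiMeasurePreserving μ)
  convert h.measurable_of_complete using 1
  ext ω
  simp

theorem MeasurableSet.setOf_forall_of_isComplete {X Ω : Type*} [MeasurableSpace X]
    [StandardBorelSpace X] [MeasurableSpace Ω] (μ : Measure Ω) [IsFiniteMeasure μ]
    [μ.IsComplete] {S : Set (X × Ω)} (hS : MeasurableSet S) :
    MeasurableSet {ω | ∀ x, (x, ω) ∈ S} := by
  convert (hS.compl.image_snd_of_isComplete μ).compl using 1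
  ext ω
  simp

/-- The graph of the pointwise minimizers of `φ` over the sections of `T` is measurable. -/
theorem measurableSet_argmin {X Ω : Type*} [MeasurableSpace X]
    [StandardBorelSpace X] [MeasurableSpace Ω] (μ : Measure Ω) [IsFiniteMeasure μ]
    [μ.IsComplete] {T : Set (X × Ω)} (hT : MeasurableSet T) {φ : X → ℝ} (hφ : Measurable φ)
    (hmin : ∀ ω, ∃ x, (x, ω) ∈ T ∧ ∀ x', (x', ω) ∈ T → φ x ≤ φ x') :
    MeasurableSet {p : X × Ω | p ∈ T ∧ ∀ x', (x', p.2) ∈ T → φ p.1 ≤ φ x'} := by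
  choose x hxT hx using hmin
  have hm : Measurable fun ω => φ (x ω) := by
    refine measurable_of_Iio fun a => ?_
    convert (hT.inter ((hφ.comp measurable_fst) measurableSet_Iio)).image_snd_of_isComplete μ
      (S := T ∩ (φ ∘ Prod.fst) ⁻¹' Iio a) using 1
    ext ω
    simp only [mem_preimage, mem_Iio, mem_image, Prod.exists, exists_eq_right, mem_inter_iff,
      Function.comp_apply]
    exact ⟨fun h => ⟨x ω, hxT ω, h⟩, fun ⟨y, hy, hya⟩ => (hx ω y hy).trans_lt hya⟩
  convert hT.inter (measurableSet_le (hφ.comp measurable_fst) (hm.comp measurable_snd)) using 1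
  ext ⟨y, ω⟩
  simp only [mem_inter_iff, mem_ofPred_eq, Function.comp_apply]
  exact and_congr_right fun _ => ⟨fun h => h _ (hxT ω), fun h y' hy' => h.trans (hx ω y' hy')⟩

/-- A nonempty closed-valued random set in `ι → ℝ` with measurable graph has a measurable selection. -/
theorem exists_measurable_selection_of_isClosed {ι Ω : Type*} [Fintype ι] [MeasurableSpace Ω]
    (μ : Measure Ω) [IsFiniteMeasure μ] [μ.IsComplete] {T : Set ((ι → ℝ) × Ω)}
    (hT : MeasurableSet T) (hclosed : ∀ ω, IsClosed {v | (v, ω) ∈ T})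
    (hne : ∀ ω, {v | (v, ω) ∈ T}.Nonempty) :
    ∃ f : Ω → ι → ℝ, Measurable f ∧ ∀ ω, (f ω, ω) ∈ T := by
  classical
  have key : ∀ s : Finset ι, ∃ T' ⊆ T, MeasurableSet T' ∧
      (∀ ω, IsCompact {v | (v, ω) ∈ T'}) ∧ (∀ ω, {v | (v, ω) ∈ T'}.Nonempty) ∧
      ∀ ω v w, (v, ω) ∈ T' → (w, ω) ∈ T' → ∀ i ∈ s, v i = w i := by
    intro s
    induction s using Finset.induction_on with
    | empty =>
      have hmin : ∀ ω, ∃ v, (v, ω) ∈ T ∧ ∀ v', (v', ω) ∈ T → ‖v‖ ≤ ‖v'‖ := by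
        intro ω
        obtain ⟨v, hv, hd⟩ := (hclosed ω).exists_infDist_eq_dist (hne ω) 0
        refine ⟨v, hv, fun v' hv' => ?_⟩
        have := infDist_le_dist_of_mem (x := 0) (s := {v | (v, ω) ∈ T}) hv'
        rwa [hd, dist_zero_left, dist_zero_left] at this
      refine ⟨{p | p ∈ T ∧ ∀ v', (v', p.2) ∈ T → ‖p.1‖ ≤ ‖v'‖}, fun p hp => hp.1,
        measurableSet_argmin μ hT measurable_norm hmin,
        fun ω => ?_, fun ω => hmin ω, by simp⟩
      obtain ⟨v, hv, hvmin⟩ := hmin ω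
      suffices h : {w | (w, ω) ∈ {p | p ∈ T ∧ ∀ v', (v', p.2) ∈ T → ‖p.1‖ ≤ ‖v'‖}} =
          {w | (w, ω) ∈ T} ∩ closedBall 0 ‖v‖ by
        rw [h]
        exact (isCompact_closedBall 0 ‖v‖).inter_left (hclosed ω)
      ext w
      simp only [mem_ofPred_eq, mem_inter_iff, mem_closedBall_zero_iff]
      exact and_congr_right fun _ => ⟨fun h => h _ hv, fun h y' hy' => h.trans (hvmin y' hy')⟩
    | insert i s _ ih =>
      obtain ⟨T', hsub, hT', hcpt, hne', heq⟩ := ih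
      have hmin : ∀ ω, ∃ v, (v, ω) ∈ T' ∧ ∀ v', (v', ω) ∈ T' → v i ≤ v' i := fun ω =>
        (hcpt ω).exists_isMinOn (hne' ω) (continuous_apply i).continuousOn
      refine ⟨_, fun p hp => hsub hp.1,
        measurableSet_argmin μ hT' (measurable_pi_apply i) hmin,
        fun ω => ?_, fun ω => hmin ω, ?_⟩
      · obtain ⟨v, hv, hvmin⟩ := hmin ω
        convert (hcpt ω).inter_right
          (isClosed_le (continuous_apply i) (continuous_const (y := v i))) using 1
        ext w
        simp only [mem_ofPred_eq, mem_inter_iff]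
        exact and_congr_right fun _ => ⟨fun h => h _ hv, fun h y' hy' => h.trans (hvmin y' hy')⟩
      · intro ω v w hv hw j hj
        rcases Finset.mem_insert.1 hj with rfl | hj
        · exact le_antisymm (hv.2 w hw.1) (hw.2 v hv.1)
        · exact heq ω v w hv.1 hw.1 j hj
  obtain ⟨T', hsub, hT', -, hne', heq⟩ := key Finset.univ
  choose f hf using hne'
  refine ⟨f, fun B hB => ?_, fun ω => hsub (hf ω)⟩
  convert (hT'.inter (measurable_fst hB)).image_snd_of_isComplete μ using 1
  ext ω
  simp only [mem_preimage, mem_image, Prod.exists, exists_eq_right, mem_inter_iff]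
  refine ⟨fun h => ⟨f ω, hf ω, h⟩, fun ⟨v, hv, hvB⟩ => ?_⟩
  rwa [show f ω = v from funext fun i => heq ω _ _ (hf ω) hv i (Finset.mem_univ i)]

theorem measurable_uncurry_of_lowerSemicontinuous {X Ω β : Type*} [TopologicalSpace X]
    [SecondCountableTopology X] [MeasurableSpace X] [OpensMeasurableSpace X]
    [MeasurableSpace Ω] [TopologicalSpace β] [LinearOrder β] [OrderTopology β]
    [SecondCountableTopology β] [MeasurableSpace β] [BorelSpace β] {F : X → Ω → β}
    (hlsc : ∀ ω, LowerSemicontinuous fun x => F x ω)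
    (hF : ∀ U, IsOpen U → ∀ a, MeasurableSet {ω | ∀ x ∈ U, a < F x ω}) :
    Measurable fun p : X × Ω => F p.1 p.2 := by
  refine measurable_of_Ioi fun a => ?_
  have hb := TopologicalSpace.isBasis_countableBasis X
  convert MeasurableSet.biUnion (TopologicalSpace.countable_countableBasis X) fun U hU =>
    (hb.isOpen hU).measurableSet.prod (hF U (hb.isOpen hU) a) using 1
  ext ⟨x, ω⟩
  simp only [mem_preimage, mem_Ioi, mem_iUnion, mem_prod, mem_ofPred_eq, exists_prop]
  refine ⟨fun h => ?_, fun ⟨U, _, hxU, hU⟩ => hU x hxU⟩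
  obtain ⟨U, hU, hxU, hsub⟩ := hb.mem_nhds_iff.1 (hlsc ω x a h)
  exact ⟨U, hU, hxU, fun y hy => hsub hy⟩

theorem EReal.coe_le_coe_mul_iff {a l : ℝ} (hl : 0 < l) {x : EReal} :
    (a : EReal) ≤ l * x ↔ ((a / l : ℝ) : EReal) ≤ x := by
  induction x with
  | bot => simp [EReal.coe_mul_bot_of_pos hl]
  | top => simp [EReal.coe_mul_top_of_pos hl]
  | coe x => rw [← EReal.coe_mul, EReal.coe_le_coe_iff, EReal.coe_le_coe_iff, div_le_iff₀' hl]

section Horizon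

variable {E F : Type*} [NormedAddCommGroup E] [NormedSpace ℝ E] [NormedAddCommGroup F]
  [NormedSpace ℝ F]

theorem exists_forall_lt_of_lt_hor {g : E → EReal} {w : E} {y : EReal} (h : y < hor g w) :
    ∃ δ > 0, ∀ l ∈ Ioo (0 : ℝ) δ, ∀ w' ∈ closedBall w δ, y < l * g (l⁻¹ • w') := by
  simp only [hor, lt_iSup_iff] at h
  obtain ⟨δ, hδ, h⟩ := h
  exact ⟨δ, hδ, fun l hl w' hw' => h.trans_le <|
    (iInf₂_le l hl).trans (iInf₂_le w' hw')⟩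

theorem le_hor_of_forall_le {g : E → EReal} {w : E} {y : EReal} {δ : ℝ} (hδ : 0 < δ)
    (h : ∀ l ∈ Ioo (0 : ℝ) δ, ∀ w' ∈ closedBall w δ, y ≤ l * g (l⁻¹ • w')) : y ≤ hor g w :=
  le_iSup₂_of_le δ hδ <| le_iInf₂ fun l hl => le_iInf₂ fun w' hw' => h l hl w' hw'

theorem IsCompact.exists_forall_le_of_lt_hor {h : E × F → EReal} {K : Set F} (hK : IsCompact K)
    {u : E} {z : EReal} (hz : z < ⊤) (hlt : ∀ v ∈ K, z < hor h (u, v)) :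
    ∃ y > z, ∃ δ > 0, ∀ l ∈ Ioo (0 : ℝ) δ, ∀ u' ∈ closedBall u δ, ∀ v ∈ K,
      y ≤ l * h (l⁻¹ • (u', v)) := by
  suffices H : ∃ y > z, ∃ δ > 0, ∀ v ∈ K, ∀ l ∈ Ioo (0 : ℝ) δ, ∀ u' ∈ closedBall u δ,
      y ≤ l * h (l⁻¹ • (u', v)) by
    obtain ⟨y, hy, δ, hδ, H⟩ := H
    exact ⟨y, hy, δ, hδ, fun l hl u' hu' v hv => H v hv l hl u' hu'⟩
  refine hK.induction_on (p := fun s => ∃ y > z, ∃ δ > 0, ∀ v ∈ s, ∀ l ∈ Ioo (0 : ℝ) δ,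
    ∀ u' ∈ closedBall u δ, y ≤ l * h (l⁻¹ • (u', v))) ⟨⊤, hz, 1, one_pos, by simp⟩ ?_ ?_ ?_
  · rintro s t hst ⟨y, hy, δ, hδ, H⟩
    exact ⟨y, hy, δ, hδ, fun v hv => H v (hst hv)⟩
  · rintro s t ⟨y₁, hy₁, δ₁, hδ₁, H₁⟩ ⟨y₂, hy₂, δ₂, hδ₂, H₂⟩
    refine ⟨min y₁ y₂, lt_min hy₁ hy₂, min δ₁ δ₂, lt_min hδ₁ hδ₂, ?_⟩
    rintro v (hv | hv) l hl u' hu'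
    · exact (min_le_left _ _).trans <| H₁ v hv l ⟨hl.1, hl.2.trans_le (min_le_left _ _)⟩ u'
        (closedBall_subset_closedBall (min_le_left _ _) hu')
    · exact (min_le_right _ _).trans <| H₂ v hv l ⟨hl.1, hl.2.trans_le (min_le_right _ _)⟩ u'
        (closedBall_subset_closedBall (min_le_right _ _) hu')
  · intro v hv
    obtain ⟨y, hzy, hy⟩ := exists_between (hlt v hv)
    obtain ⟨δ, hδ, H⟩ := exists_forall_lt_of_lt_hor hy
    refine ⟨closedBall v δ, mem_nhdsWithin_of_mem_nhds (closedBall_mem_nhds v hδ), y, hzy, δ, hδ,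
      fun v' hv' l hl u' hu' => (H l hl (u', v') ?_).le⟩
    rw [← closedBall_prod_same]
    exact ⟨hu', hv'⟩

/-- Positivity of the horizon function in the directions `(0, v)` gives linear growth in `v`,
locally uniformly in `u`. -/
theorem exists_linear_lower_bound_of_hor_pos [ProperSpace F] {h : E × F → EReal}
    (hpos : ∀ v : F, v ≠ 0 → 0 < hor h (0, v)) :
    ∃ c > 0, ∃ R > 0, ∀ u v, R ≤ ‖v‖ → R * ‖u‖ ≤ ‖v‖ → ((c * ‖v‖ : ℝ) : EReal) ≤ h (u, v) := by
  obtain ⟨y, hy, δ, hδ, hle⟩ := (isCompact_sphere (0 : F) 1).exists_forall_le_of_lt_hor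
    (h := h) (u := 0) EReal.zero_lt_top fun v hv => hpos v (ne_zero_of_mem_unit_sphere ⟨v, hv⟩)
  obtain ⟨c, hc0, hcy⟩ := EReal.lt_iff_exists_real_btwn.1 hy
  refine ⟨c, by exact_mod_cast hc0, 2 / δ, by positivity, fun u v hv huv => ?_⟩
  have hv0 : 0 < ‖v‖ := lt_of_lt_of_le (by positivity) hv
  have hl : ‖v‖⁻¹ < δ := by
    rw [inv_lt_comm₀ hv0 hδ]
    refine lt_of_lt_of_le ?_ hv
    rw [inv_eq_one_div]
    gcongr
    norm_num
  have hu : ‖v‖⁻¹ • u ∈ closedBall (0 : E) δ := by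
    rw [mem_closedBall_zero_iff, norm_smul, norm_inv, norm_norm, inv_mul_le_iff₀ hv0]
    rw [div_mul_eq_mul_div, div_le_iff₀ hδ] at huv
    nlinarith [norm_nonneg u]
  have h1 := hcy.le.trans <| hle ‖v‖⁻¹ ⟨inv_pos.2 hv0, hl⟩ _ hu (‖v‖⁻¹ • v) (by
    simp [norm_smul, hv0.ne'])
  rwa [EReal.coe_le_coe_mul_iff (inv_pos.2 hv0), ← Prod.smul_mk, smul_smul, inv_inv,
    mul_inv_cancel₀ hv0.ne', one_smul, div_inv_eq_mul] at h1

theorem exists_forall_le_of_hor_pos [ProperSpace F] {h : E × F → EReal}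
    (hpos : ∀ v : F, v ≠ 0 → 0 < hor h (0, v)) (r M : ℝ) :
    ∃ ρ, ∀ u, ‖u‖ ≤ r → ∀ v, ρ ≤ ‖v‖ → (M : EReal) ≤ h (u, v) := by
  obtain ⟨c, hc, R, hR, hle⟩ := exists_linear_lower_bound_of_hor_pos hpos
  refine ⟨max (max R (R * r)) (M / c), fun u hu v hv => ?_⟩
  simp only [max_le_iff] at hv
  refine le_trans ?_ (hle u v hv.1.1 (le_trans (by gcongr) hv.1.2))
  rw [EReal.coe_le_coe_iff]
  exact (div_le_iff₀' hc).1 hv.2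

theorem LowerSemicontinuous.exists_eq_iInf_of_hor_pos [ProperSpace F] {h : E × F → EReal}
    (hlsc : LowerSemicontinuous h) (hpos : ∀ v : F, v ≠ 0 → 0 < hor h (0, v)) (u : E) :
    ∃ v, h (u, v) = ⨅ v', h (u, v') := by
  suffices ∃ v, ∀ v', h (u, v) ≤ h (u, v') by
    obtain ⟨v, hv⟩ := this
    exact ⟨v, le_antisymm (le_iInf hv) (iInf_le _ v)⟩
  by_cases htop : ∀ v, h (u, v) = ⊤
  · exact ⟨0, fun v' => by simp [htop]⟩
  push Not at htop
  obtain ⟨v₀, hv₀⟩ := htop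
  obtain ⟨M, hM, -⟩ := EReal.lt_iff_exists_real_btwn.1 hv₀.lt_top
  obtain ⟨ρ, hρ⟩ := exists_forall_le_of_hor_pos hpos ‖u‖ M
  obtain ⟨v, -, hv⟩ := LowerSemicontinuousOn.exists_isMinOn (f := fun v => h (u, v))
    (s := closedBall (0 : F) (max ρ ‖v₀‖)) ⟨v₀, by simp⟩ (isCompact_closedBall _ _)
    ((hlsc.comp (Continuous.prodMk_right u)).lowerSemicontinuousOn _)
  refine ⟨v, fun v' => ?_⟩
  by_cases hv' : ‖v'‖ ≤ max ρ ‖v₀‖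
  · exact hv (by simpa using hv')
  · exact (hv (by simp : v₀ ∈ _)).trans <| hM.le.trans <| hρ u le_rfl v' <|
      (le_max_left _ _).trans (not_le.1 hv').le

theorem LowerSemicontinuous.iInf_of_hor_pos [ProperSpace F] {h : E × F → EReal}
    (hlsc : LowerSemicontinuous h) (hpos : ∀ v : F, v ≠ 0 → 0 < hor h (0, v)) :
    LowerSemicontinuous fun u => ⨅ v, h (u, v) := by
  intro u y hy
  obtain ⟨M, hyM, hM⟩ := EReal.lt_iff_exists_real_btwn.1 hy
  obtain ⟨ρ, hρ⟩ := exists_forall_le_of_hor_pos hpos (‖u‖ + 1) M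
  have hK : ∀ᶠ u' in 𝓝 u, ∀ v ∈ closedBall (0 : F) ρ, (M : EReal) < h (u', v) :=
    (isCompact_closedBall (0 : F) ρ).eventually_forall_of_forall_eventually fun v _ =>
      hlsc (u, v) M (hM.trans_le (iInf_le _ v))
  have hn : ∀ᶠ u' in 𝓝 u, ‖u'‖ < ‖u‖ + 1 :=
    continuous_norm.tendsto u (Iio_mem_nhds (lt_add_one _))
  filter_upwards [hK, hn] with u' hu' hn'
  refine hyM.trans_le (le_iInf fun v => ?_)
  rcases le_total ‖v‖ ρ with hv | hv
  · exact (hu' v (by simpa using hv)).le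
  · exact hρ u' hn'.le v hv

theorem hor_iInf_of_hor_pos [ProperSpace F] {h : E × F → EReal}
    (hpos : ∀ v : F, v ≠ 0 → 0 < hor h (0, v)) (u : E) :
    hor (fun u' => ⨅ v, h (u', v)) u = ⨅ v, hor h (u, v) := by
  apply le_antisymm
  · refine le_iInf fun v => iSup₂_le fun δ hδ => le_hor_of_forall_le hδ ?_
    rintro l hl ⟨u', v'⟩ hw
    rw [← closedBall_prod_same] at hw
    refine (iInf₂_le l hl).trans <| (iInf₂_le u' hw.1).trans ?_
    exact mul_le_mul_of_nonneg_left (iInf_le _ (l⁻¹ • v')) (by exact_mod_cast hl.1.le)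
  · refine le_of_forall_lt fun y hy => ?_
    obtain ⟨M, hyM, hM⟩ := EReal.lt_iff_exists_real_btwn.1 hy
    refine hyM.trans_le ?_
    obtain ⟨c, hc, R, hR, hle⟩ := exists_linear_lower_bound_of_hor_pos hpos
    obtain ⟨y', hy', δ, hδ, hK⟩ := (isCompact_closedBall (0 : F)
      (max (max R (R * (‖u‖ + 1))) (M / c))).exists_forall_le_of_lt_hor (h := h) (u := u)
      (EReal.coe_lt_top M) fun v _ => hM.trans_le (iInf_le _ v)
    refine le_hor_of_forall_le (lt_min hδ one_pos) fun l hl u' hu' => ?_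
    have hl1 : l < 1 := hl.2.trans_le (min_le_right _ _)
    rw [EReal.coe_le_coe_mul_iff hl.1]
    refine le_iInf fun v => ?_
    by_cases hv : ‖l • v‖ ≤ max (max R (R * (‖u‖ + 1))) (M / c)
    · have := hy'.le.trans <| hK l ⟨hl.1, hl.2.trans_le (min_le_left _ _)⟩ u'
        (closedBall_subset_closedBall (min_le_left _ _) hu') (l • v) (by simpa using hv)
      rwa [EReal.coe_le_coe_mul_iff hl.1, Prod.smul_mk, smul_smul, inv_mul_cancel₀ hl.1.ne',
        one_smul] at this
    · simp only [not_le, max_lt_iff, norm_smul, Real.norm_of_nonneg hl.1.le] at hv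
      obtain ⟨⟨hv1, hv2⟩, hv3⟩ := hv
      have hu1 : ‖u'‖ ≤ ‖u‖ + 1 := by
        have := norm_le_norm_add_norm_sub' u' u
        have h2 := (mem_closedBall_iff_norm.1 hu').trans (min_le_right _ _)
        linarith
      refine le_trans ?_ (hle (l⁻¹ • u') v ?_ ?_)
      · rw [EReal.coe_le_coe_iff, div_le_iff₀ hl.1]
        rw [div_lt_iff₀ hc] at hv3
        linarith
      · nlinarith [norm_nonneg v]
      · rw [norm_smul, norm_inv, Real.norm_of_nonneg hl.1.le, mul_left_comm,
          inv_mul_le_iff₀ hl.1]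
        exact (mul_le_mul_of_nonneg_left hu1 hR.le).trans hv2.le

end Horizon

/-- partial minimization of a normal integrand under a horizon condition:
the inf-projection is again a normal integrand, the infimum is attained, the horizon
of the projection is the projection of the horizon, and a measurable minimizing
selection exists. -/
theorem inf_projection_normal_integrand {m k : ℕ} {Ω : Type*} [MeasurableSpace Ω]
    (μ : Measure Ω) [IsProbabilityMeasure μ] (hcomp : μ.IsComplete)
    (H : ((Fin m → ℝ) × (Fin k → ℝ)) → Ω → EReal)
    (Hmeas : Measurable fun p : ((Fin m → ℝ) × (Fin k → ℝ)) × Ω => H p.1 p.2)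
    (Hlsc : ∀ ω, LowerSemicontinuous fun uv => H uv ω)
    (m₀ : Ω → ℝ) (hm₀ : Integrable m₀ μ)
    (Hbd : ∀ uv ω, (m₀ ω : EReal) ≤ H uv ω)
    (Hhor : ∀ ω, ∀ v : Fin k → ℝ, v ≠ 0 →
      0 < hor (fun uv => H uv ω) ((0 : Fin m → ℝ), v)) :
    -- (i) the inf-projection is a normal integrand and the infimum is attained
    (Measurable fun p : (Fin m → ℝ) × Ω => ⨅ v, H (p.1, v) p.2) ∧
    (∀ ω, LowerSemicontinuous fun u => ⨅ v, H (u, v) ω) ∧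
    (∀ (u : Fin m → ℝ) (ω : Ω), ∃ v : Fin k → ℝ, H (u, v) ω = ⨅ v', H (u, v') ω) ∧
    -- (ii) the horizon function of the projection is the projection of the horizon
    (∀ (u : Fin m → ℝ) (ω : Ω),
      hor (fun u' => ⨅ v, H (u', v) ω) u = ⨅ v, hor (fun uv => H uv ω) (u, v)) ∧
    -- (iii) measurable minimizing selection
    (∀ x : Ω → Fin m → ℝ, Measurable x → ∃ vbar : Ω → Fin k → ℝ, Measurable vbar ∧
      ∀ ω, (⨅ v, H (x ω, v) ω) = H (x ω, vbar ω) ω) := by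
  have hlsc : ∀ ω, LowerSemicontinuous fun u => ⨅ v, H (u, v) ω := fun ω =>
    (Hlsc ω).iInf_of_hor_pos (Hhor ω)
  have hatt : ∀ u ω, ∃ v, H (u, v) ω = ⨅ v', H (u, v') ω := fun u ω =>
    (Hlsc ω).exists_eq_iInf_of_hor_pos (Hhor ω) u
  have hmeas : Measurable fun p : (Fin m → ℝ) × Ω => ⨅ v, H (p.1, v) p.2 := by
    refine measurable_uncurry_of_lowerSemicontinuous (F := fun u ω => ⨅ v, H (u, v) ω) hlsc
      fun U hU a => ?_
    have hS : MeasurableSet {p : ((Fin m → ℝ) × (Fin k → ℝ)) × Ω | p.1.1 ∈ U → a < H p.1 p.2} :=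
      ((measurable_fst.comp measurable_fst) hU.measurableSet).imp
        (measurableSet_lt measurable_const Hmeas)
    convert hS.setOf_forall_of_isComplete μ using 1
    ext ω
    simp only [mem_ofPred_eq, Prod.forall]
    refine ⟨fun h u v hu => (h u hu).trans_le (iInf_le _ v), fun h u hu => ?_⟩
    obtain ⟨v, hv⟩ := hatt u ω
    exact hv ▸ h u v hu
  refine ⟨hmeas, hlsc, hatt, fun u ω => hor_iInf_of_hor_pos (Hhor ω) u, fun x hx => ?_⟩
  have hT : MeasurableSet {p : (Fin k → ℝ) × Ω | H (x p.2, p.1) p.2 ≤ ⨅ v, H (x p.2, v) p.2} :=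
    measurableSet_le
      (Hmeas.comp (((hx.comp measurable_snd).prodMk measurable_fst).prodMk measurable_snd))
      (hmeas.comp ((hx.comp measurable_snd).prodMk measurable_snd))
  obtain ⟨vbar, hvbar, hv⟩ := exists_measurable_selection_of_isClosed μ hT
    (fun ω => ((Hlsc ω).comp (Continuous.prodMk_right (x ω))).isClosed_preimage
      (⨅ v, H (x ω, v) ω))
    (fun ω => (hatt (x ω) ω).imp fun v hv => hv.le)
  exact ⟨vbar, hvbar, fun ω => le_antisymm (iInf_le _ _) (hv ω)⟩

end
end

section
/- In the dynamic programming framework, assume that for each t = 0,…,T there is a P-null set outside of which h_t^∞((0,x_t),ω) > 0 for every x_t ∈ ℝ^{n_t} \ {0} (horizon of h_t in its full argument, evaluated at the point whose first n_0+⋯+n_{t−1} coordinates vanish). Then an optimal solution to problem (P) exists: there is x ∈ N with Eh(x) = inf_{x′ ∈ N} Eh(x′). -/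
open Filter MeasureTheory Metric Set
open scoped Topology ENNReal

noncomputable section

/-- Positive part of an extended real, as an extended nonnegative real. -/
def ePos (x : EReal) : ℝ≥0∞ := if x = ⊤ then ⊤ else ENNReal.ofReal x.toReal

/-- The extended integral of an EReal-valued function (well defined in (−∞,+∞] when
the negative part is integrable). -/
def eInt {Ω : Type*} [MeasurableSpace Ω] (μ : Measure Ω) (f : Ω → EReal) : EReal :=
  ((∫⁻ ω, ePos (f ω) ∂μ : ℝ≥0∞) : EReal) + (-((∫⁻ ω, ePos (-(f ω)) ∂μ : ℝ≥0∞) : EReal))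

/-- The state space ℝⁿ = ℝ^{n₀} × ⋯ × ℝ^{n_T}. -/
abbrev Strat (T : ℕ) (n : Fin (T+1) → ℕ) := (t : Fin (T+1)) → Fin (n t) → ℝ


/-- A compact set in a product admits a Borel selection over its first projection. -/
theorem exists_measurable_selection_of_isCompact {X Y : Type*}
    [TopologicalSpace X] [PolishSpace X] [MeasurableSpace X] [BorelSpace X]
    [TopologicalSpace Y] [PolishSpace Y] [MeasurableSpace Y] [BorelSpace Y] [Nonempty Y]
    {L : Set (X × Y)} (hL : IsCompact L) :
    ∃ s : X → Y, Measurable s ∧ ∀ x ∈ Prod.fst '' L, (x, s x) ∈ L := by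
  classical
  rcases L.eq_empty_or_nonempty with rfl | hne
  · exact ⟨fun _ => Classical.arbitrary Y, measurable_const, by simp⟩
  have : Nonempty L := hne.to_subtype
  have : CompactSpace L := isCompact_iff_compactSpace.1 hL
  let : MetricSpace L := TopologicalSpace.metrizableSpaceMetric L
  obtain ⟨g₀, hg₀, hsurj⟩ := exists_nat_bool_continuous_surjective_of_compact L
  have : CompactSpace cantorSet := isCompact_iff_compactSpace.1 isCompact_cantorSet
  let g : cantorSet → X × Y := fun c => (g₀ (cantorSetHomeomorphNatToBool c)).1
  have hg : Continuous g :=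
    continuous_subtype_val.comp (hg₀.comp cantorSetHomeomorphNatToBool.continuous)
  have hgL : ∀ c, g c ∈ L := fun c => (g₀ (cantorSetHomeomorphNatToBool c)).2
  have hgsurj : ∀ z ∈ L, ∃ c, g c = z := by
    intro z hz
    obtain ⟨b, hb⟩ := hsurj ⟨z, hz⟩
    exact ⟨cantorSetHomeomorphNatToBool.symm b, by simp [g, hb]⟩
  have hleast : ∀ x ∈ Prod.fst '' L, ∃ c : cantorSet, (g c).1 = x ∧
      ∀ c' : cantorSet, (g c').1 = x → (c : ℝ) ≤ c' := by
    rintro _ ⟨z, hz, rfl⟩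
    have hcl : IsClosed {c : cantorSet | (g c).1 = z.1} :=
      isClosed_eq (continuous_fst.comp hg) continuous_const
    obtain ⟨c, hc⟩ := hgsurj z hz
    obtain ⟨c₁, h₁, h₂⟩ := hcl.isCompact.exists_isMinOn (f := fun c : cantorSet => (c : ℝ))
      ⟨c, by simp [hc]⟩ continuous_subtype_val.continuousOn
    exact ⟨c₁, h₁, fun c' hc' => h₂ hc'⟩
  have : Nonempty cantorSet := ⟨⟨_, zero_mem_cantorSet⟩⟩
  choose! σ hσ hσmin using hleast
  have hD : IsCompact (Prod.fst '' L) := hL.image continuous_fst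
  have hDm : MeasurableSet (Prod.fst '' L) := hD.isClosed.measurableSet
  obtain ⟨z₀, hz₀⟩ := hne
  obtain ⟨c₀, -⟩ := hgsurj z₀ hz₀
  let τ : X → cantorSet := fun x => if x ∈ Prod.fst '' L then σ x else c₀
  have hτ : Measurable τ := by
    refine Measurable.subtype_mk (f := fun x => ((τ x : cantorSet) : ℝ))
      (hf := measurable_of_Iic fun a => ?_) (h := fun x => (τ x).2)
    have hpre : (fun x => ((τ x : cantorSet) : ℝ)) ⁻¹' Iic a =
        ((fun c => (g c).1) '' {c : cantorSet | (c : ℝ) ≤ a}) ∪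
          ((Prod.fst '' L)ᶜ ∩ {_x | (c₀ : ℝ) ≤ a}) := by
      ext x
      by_cases hx : x ∈ Prod.fst '' L
      · simp only [mem_preimage, mem_Iic, τ, mem_union, mem_inter_iff, mem_compl_iff,
          hx, not_true_eq_false, false_and, or_false]
        constructor
        · intro h
          exact ⟨σ x, h, hσ x hx⟩
        · rintro ⟨c, hc, hcx⟩
          exact (hσmin x hx c hcx).trans hc
      · simp only [mem_preimage, mem_Iic, τ, mem_union, mem_inter_iff, mem_compl_iff,
          hx, not_false_eq_true, true_and, mem_ofPred_eq]
        constructor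
        · exact Or.inr
        · rintro (⟨c, hc, hcx⟩ | h)
          · exact absurd ⟨g c, hgL c, hcx⟩ hx
          · exact h
    show MeasurableSet ((fun x => ((τ x : cantorSet) : ℝ)) ⁻¹' Iic a)
    rw [hpre]
    refine MeasurableSet.union ?_ (hDm.compl.inter (MeasurableSet.const _))
    refine (IsCompact.image ?_ (continuous_fst.comp hg)).isClosed.measurableSet
    exact (isClosed_le continuous_subtype_val continuous_const).isCompact
  refine ⟨fun x => (g (τ x)).2, (continuous_snd.comp hg).measurable.comp hτ, fun x hx => ?_⟩
  have h1 : τ x = σ x := if_pos hx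
  have h2 : (x, (g (τ x)).2) = g (σ x) := by
    rw [h1]
    exact Prod.ext (hσ x hx).symm rfl
  simp only [h2]
  exact hgL _

/-- Continuous images of Baire space can be approximated in measure from inside by images of
compact sets. -/
theorem exists_isCompact_le_measure_image {X : Type*} [TopologicalSpace X] [MeasurableSpace X]
    (ν : Measure X) [ν.OuterRegular] {p : (ℕ → ℕ) → X} (hp : Continuous p) {c : ℝ≥0∞}
    (hc : c < ν (range p)) : ∃ K : Set (ℕ → ℕ), IsCompact K ∧ c ≤ ν (p '' K) := by
  classical
  have hstep : ∀ (n : ℕ) (S : {S : Set (ℕ → ℕ) // c < ν (p '' S)}),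
      ∃ j : ℕ, c < ν (p '' (S.1 ∩ {x | x n ≤ j})) := by
    rintro n ⟨S, hS⟩
    have hmono : Monotone fun j : ℕ => p '' (S ∩ {x | x n ≤ j}) := fun i j hij =>
      image_mono (inter_subset_inter_right _ fun x (hx : x n ≤ i) => le_trans hx hij)
    have hU : p '' S = ⋃ j : ℕ, p '' (S ∩ {x | x n ≤ j}) := by
      rw [← image_iUnion, ← inter_iUnion]
      congr 1
      refine (inter_eq_left.2 fun x _ => mem_iUnion.2 ⟨x n, le_refl (x n)⟩).symm
    rw [hU, hmono.measure_iUnion] at hS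
    exact lt_iSup_iff.1 hS
  choose M hM using hstep
  let seq : ℕ → {S : Set (ℕ → ℕ) // c < ν (p '' S)} := fun n =>
    Nat.rec ⟨univ, by rwa [image_univ]⟩ (fun n S => ⟨S.1 ∩ {x | x n ≤ M n S}, hM n S⟩) n
  let k : ℕ → ℕ := fun n => M n (seq n)
  have hseq : ∀ n, (seq n).1 = {x | ∀ i < n, x i ≤ k i} := by
    intro n
    induction n with
    | zero => simp [seq]
    | succ n ih =>
      have : (seq (n+1)).1 = (seq n).1 ∩ {x | x n ≤ k n} := rfl
      rw [this, ih]
      ext x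
      simp only [mem_inter_iff, mem_ofPred_eq, Nat.lt_succ_iff_lt_or_eq]
      constructor
      · rintro ⟨h1, h2⟩ i (hi | rfl)
        · exact h1 i hi
        · exact h2
      · exact fun h => ⟨fun i hi => h i (Or.inl hi), h n (Or.inr rfl)⟩
  have hK : IsCompact (Set.pi univ fun i => Iic (k i)) :=
    isCompact_univ_pi fun i => (finite_Iic (k i)).isCompact
  refine ⟨_, hK, ?_⟩
  by_contra! hlt
  obtain ⟨U, hKU, hU, hνU⟩ := Set.exists_isOpen_lt_of_lt _ _ hlt
  have hsub : ∃ n, (seq n).1 ⊆ p ⁻¹' U := by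
    by_contra! hno
    simp only [not_subset] at hno
    choose x hxS hxU using hno
    let y : ℕ → ℕ → ℕ := fun n i => min (x n i) (k i)
    obtain ⟨z, hz, φ, hφ, hlim⟩ := hK.tendsto_subseq (x := y)
      (fun n i _ => mem_Iic.2 (min_le_right _ _))
    have hlim' : Tendsto (x ∘ φ) atTop (𝓝 z) := by
      rw [tendsto_pi_nhds] at hlim ⊢
      intro i
      refine (hlim i).congr' ?_
      filter_upwards [eventually_gt_atTop i] with n hn
      have := hxS (φ n)
      rw [hseq] at this
      exact min_eq_left (this i (hn.trans_le (hφ.id_le n)))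
    have hcl : IsClosed (p ⁻¹' U)ᶜ := (hU.preimage hp).isClosed_compl
    exact hcl.mem_of_tendsto hlim' (Eventually.of_forall fun n => hxU (φ n))
      (hKU (mem_image_of_mem p hz))
  obtain ⟨n, hn⟩ := hsub
  exact absurd ((seq n).2.trans_le (measure_mono (image_subset_iff.2 hn))) hνU.not_gt

/-- Measurable selection in a product of Polish spaces, up to a null set. -/
theorem exists_measurable_selection_of_polish {X Y : Type*}
    [TopologicalSpace X] [PolishSpace X] [MeasurableSpace X] [BorelSpace X]
    [TopologicalSpace Y] [PolishSpace Y] [MeasurableSpace Y] [BorelSpace Y] [Nonempty Y]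
    (ν : Measure X) [IsFiniteMeasure ν] {A : Set (X × Y)} (hA : MeasurableSet A) :
    ∃ s : X → Y, Measurable s ∧ ∀ᵐ x ∂ν, ∀ y, (x, y) ∈ A → (x, s x) ∈ A := by
  classical
  have han := hA.analyticSet
  rw [AnalyticSet] at han
  rcases han with rfl | ⟨f, hf, rfl⟩
  · exact ⟨fun _ => Classical.arbitrary Y, measurable_const, by simp⟩
  let : MetricSpace X := TopologicalSpace.metrizableSpaceMetric X
  set p : (ℕ → ℕ) → X := fun k => (f k).1 with hpdef
  have hp : Continuous p := continuous_fst.comp hf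
  have hR : ν (range p) ≠ ⊤ := measure_ne_top _ _
  have hKex : ∀ j : ℕ, ∃ K : Set (ℕ → ℕ), IsCompact K ∧
      ν (range p) - ((j : ℝ≥0∞) + 1)⁻¹ ≤ ν (p '' K) := by
    intro j
    rcases eq_or_ne (ν (range p)) 0 with h0 | h0
    · exact ⟨∅, isCompact_empty, by simp [h0]⟩
    · exact exists_isCompact_le_measure_image ν hp
        (ENNReal.sub_lt_self hR h0 (by simp))
  choose K hKc hKν using hKex
  have hL : ∀ j, IsCompact (f '' K j) := fun j => (hKc j).image hf
  choose s hsm hs using fun j => exists_measurable_selection_of_isCompact (hL j)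
  have himg : ∀ j, Prod.fst '' (f '' K j) = p '' K j := fun j => by rw [image_image]
  let t : ℕ → Set X := fun j => p '' K j
  have htm : ∀ j, MeasurableSet (t j) := fun j => ((hKc j).image hp).isClosed.measurableSet
  obtain ⟨s', hs'm, hs'⟩ := exists_measurable_piecewise (disjointed t)
    (MeasurableSet.disjointed htm) s hsm (by
      intro i j hij x hx
      exact absurd hx (by
        rw [(disjoint_disjointed t hij).inter_eq]
        exact notMem_empty x))
  refine ⟨s', hs'm, ?_⟩
  have hUm : MeasurableSet (⋃ j, t j) := MeasurableSet.iUnion htm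
  have hUR : (⋃ j, t j) ⊆ range p := iUnion_subset fun j => image_subset_range _ _
  have hle : ν (range p) ≤ ν (⋃ j, t j) := by
    have h1 : Tendsto (fun j : ℕ => ν (range p) - ((j : ℝ≥0∞) + 1)⁻¹) atTop
        (𝓝 (ν (range p) - 0)) := by
      refine ENNReal.Tendsto.sub tendsto_const_nhds ?_ (Or.inl hR)
      have := (tendsto_add_atTop_iff_nat 1).2 ENNReal.tendsto_inv_nat_nhds_zero
      simpa using this
    rw [tsub_zero] at h1
    exact le_of_tendsto' h1 fun j => (hKν j).trans (measure_mono (subset_iUnion t j))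
  have hnull : ν (range p \ ⋃ j, t j) = 0 := by
    rw [measure_sdiff hUR hUm.nullMeasurableSet (measure_ne_top _ _)]
    exact tsub_eq_zero_of_le hle
  rw [measure_eq_zero_iff_ae_notMem] at hnull
  filter_upwards [hnull] with x hx y hy
  have hxR : x ∈ range p := by
    obtain ⟨k, hk⟩ := hy
    exact ⟨k, by simp [hpdef, hk]⟩
  have hxU : x ∈ ⋃ j, t j := by
    by_contra h
    exact hx ⟨hxR, h⟩
  rw [← iUnion_disjointed, mem_iUnion] at hxU
  obtain ⟨j, hj⟩ := hxU
  rw [hs' j hj]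
  have := hs j x (by rw [himg]; exact disjointed_subset t j hj)
  exact image_subset_range _ _ this

/-- A measurable subset of a product with an arbitrary measurable space is a pullback from a
product with the Cantor space. -/
theorem exists_measurable_preimage_prod {Ω Y : Type*} [MeasurableSpace Ω] [MeasurableSpace Y]
    {A : Set (Ω × Y)} (hA : MeasurableSet A) :
    ∃ (φ : Ω → ℕ → Bool) (B : Set ((ℕ → Bool) × Y)), Measurable φ ∧ MeasurableSet B ∧
      A = {z | (φ z.1, z.2) ∈ B} := by
  classical
  have hgen := (generateFrom_prod (α := Ω) (β := Y)).symm
  induction A, hA using MeasurableSpace.induction_on_inter hgen isPiSystem_prod with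
  | empty => exact ⟨fun _ _ => false, ∅, measurable_const, MeasurableSet.empty, by simp⟩
  | basic S hS =>
    obtain ⟨s, hs, t, ht, rfl⟩ := hS
    refine ⟨fun ω _ => decide (ω ∈ s), {b | b 0 = true} ×ˢ t, ?_, ?_, ?_⟩
    · refine measurable_pi_lambda _ fun _ => ?_
      exact measurable_to_bool (by simpa [preimage] using hs)
    · exact ((measurableSet_singleton true).preimage (measurable_pi_apply 0)).prod ht
    · ext z
      simp
  | compl S hS ih =>
    obtain ⟨φ, B, hφ, hB, rfl⟩ := ih
    exact ⟨φ, Bᶜ, hφ, hB.compl, rfl⟩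
  | iUnion S hd hS ih =>
    choose φ B hφ hB hS' using ih
    refine ⟨fun ω j => φ j.unpair.1 ω j.unpair.2,
      ⋃ n, {z | ((fun j => z.1 (Nat.pair n j)), z.2) ∈ B n}, ?_, ?_, ?_⟩
    · exact measurable_pi_lambda _ fun j => (measurable_pi_apply _).comp (hφ _)
    · refine MeasurableSet.iUnion fun n => ?_
      have : Measurable fun z : (ℕ → Bool) × Y => ((fun j => z.1 (Nat.pair n j)), z.2) :=
        (measurable_pi_lambda _ fun j => (measurable_pi_apply _).comp measurable_fst).prodMk
          measurable_snd
      exact this (hB n)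
    · ext z
      simp only [mem_iUnion, mem_ofPred_eq, Nat.unpair_pair]
      refine exists_congr fun n => ?_
      rw [hS' n]
      rfl

/-- Aumann's measurable selection theorem, up to a null set. -/
theorem exists_measurable_ae_selection {Ω Y : Type*} [MeasurableSpace Ω]
    [TopologicalSpace Y] [PolishSpace Y] [MeasurableSpace Y] [BorelSpace Y] [Nonempty Y]
    (ν : Measure Ω) [IsFiniteMeasure ν] {A : Set (Ω × Y)} (hA : MeasurableSet A) :
    ∃ s : Ω → Y, Measurable s ∧ ∀ᵐ ω ∂ν, ∀ y, (ω, y) ∈ A → (ω, s ω) ∈ A := by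
  obtain ⟨φ, B, hφ, hB, rfl⟩ := exists_measurable_preimage_prod hA
  have := isClosed_cantorSet.polishSpace
  have : PolishSpace (ℕ → Bool) :=
    cantorSetHomeomorphNatToBool.symm.isClosedEmbedding.polishSpace
  obtain ⟨s, hs, h⟩ := exists_measurable_selection_of_polish (ν.map φ) hB
  exact ⟨s ∘ φ, hs.comp hφ, ae_of_ae_map hφ.aemeasurable h⟩

/-- A jointly measurable function admits a measurable selection of its minimizers, up to a
null set. -/
theorem exists_measurable_argmin {Ω Y : Type*} [MeasurableSpace Ω]
    [TopologicalSpace Y] [PolishSpace Y] [MeasurableSpace Y] [BorelSpace Y] [Nonempty Y]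
    (ν : Measure Ω) [IsFiniteMeasure ν] {g : Ω × Y → EReal} (hg : Measurable g) :
    ∃ s : Ω → Y, Measurable s ∧ ∀ᵐ ω ∂ν, ∀ y, (∀ y', g (ω, y) ≤ g (ω, y')) →
      ∀ y', g (ω, s ω) ≤ g (ω, y') := by
  have hv : AEMeasurable (fun ω => ⨅ y, g (ω, y)) ν := by
    refine NullMeasurable.aemeasurable ?_
    refine @measurable_of_Iio EReal (NullMeasurableSpace Ω ν) _ _ _ _ _ _ _ _ fun a => ?_
    obtain ⟨s, hs, h⟩ := exists_measurable_ae_selection ν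
      (hg measurableSet_Iio : MeasurableSet (g ⁻¹' Iio a))
    have hm : MeasurableSet {ω | g (ω, s ω) < a} :=
      (hg.comp (measurable_id.prodMk hs)) measurableSet_Iio
    refine NullMeasurableSet.congr hm.nullMeasurableSet ?_
    filter_upwards [h] with ω hω
    refine propext ?_
    show g (ω, s ω) < a ↔ (⨅ y, g (ω, y)) < a
    rw [iInf_lt_iff]
    exact ⟨fun h => ⟨_, h⟩, fun ⟨y, hy⟩ => hω y hy⟩
  obtain ⟨s, hs, h⟩ := exists_measurable_ae_selection ν
    (measurableSet_le hg (hv.measurable_mk.comp measurable_fst))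
  refine ⟨s, hs, ?_⟩
  filter_upwards [h, hv.ae_eq_mk] with ω h1 h2 y hy y'
  have h3 := h1 y (by
    show g (ω, y) ≤ hv.mk _ ω
    rw [← h2]
    exact le_iInf hy)
  have h4 : g (ω, s ω) ≤ hv.mk _ ω := h3
  rw [← h2] at h4
  exact h4.trans (iInf_le _ y')

/-- The positive part is monotone. -/
theorem ePos_mono {x y : EReal} (hxy : x ≤ y) : ePos x ≤ ePos y := by
  unfold ePos
  split_ifs with h1 h2 h2
  · exact le_rfl
  · exact absurd (top_le_iff.1 (h1 ▸ hxy)) h2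
  · exact le_top
  · rcases eq_or_ne x ⊥ with rfl | hx
    · simp
    · exact ENNReal.ofReal_le_ofReal (EReal.toReal_le_toReal hxy hx h2)

/-- The extended integral is monotone, without any integrability assumption. -/
theorem eInt_mono_ae {Ω : Type*} [MeasurableSpace Ω] {μ : Measure Ω} {f g : Ω → EReal}
    (hfg : ∀ᵐ ω ∂μ, f ω ≤ g ω) : eInt μ f ≤ eInt μ g := by
  refine add_le_add ?_ (EReal.neg_le_neg_iff.2 ?_)
  · exact EReal.coe_ennreal_le_coe_ennreal_iff.2
      (lintegral_mono_ae (hfg.mono fun ω h => ePos_mono h))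
  · exact EReal.coe_ennreal_le_coe_ennreal_iff.2
      (lintegral_mono_ae (hfg.mono fun ω h => ePos_mono (EReal.neg_le_neg_iff.2 h)))

/-- A positive horizon function forbids bounded values along a sequence escaping to infinity
in the corresponding direction. -/
theorem hor_nonpos_of_tendsto {E : Type*} [SeminormedAddCommGroup E] [NormedSpace ℝ E]
    {g : E → EReal} {w : E} {a : ℝ} (z : ℕ → E) (l : ℕ → ℝ) (hl : ∀ k, 0 < l k)
    (hl0 : Tendsto l atTop (𝓝 0)) (hz : Tendsto (fun k => l k • z k) atTop (𝓝 w))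
    (hg : ∀ k, g (z k) ≤ a) : hor g w ≤ 0 := by
  refine iSup₂_le fun δ hδ => EReal.le_of_forall_lt_iff_le.1 fun ε hε => ?_
  have hε' : (0 : ℝ) < ε := by exact_mod_cast hε
  have h1 : Tendsto (fun k => l k * a) atTop (𝓝 0) := by simpa using hl0.mul_const a
  obtain ⟨k, hk1, hk2, hk3⟩ := ((hl0.eventually_lt_const hδ).and
    ((hz.eventually_mem (closedBall_mem_nhds w hδ)).and (h1.eventually_lt_const hε'))).exists
  refine (iInf₂_le (l k) ⟨hl k, hk1⟩).trans ((iInf₂_le (l k • z k) hk2).trans ?_)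
  rw [inv_smul_smul₀ (hl k).ne']
  calc (l k : EReal) * g (z k) ≤ (l k : EReal) * (a : EReal) :=
        mul_le_mul_of_nonneg_left (hg k) (by exact_mod_cast (hl k).le)
    _ = ((l k * a : ℝ) : EReal) := by push_cast; rfl
    _ ≤ ε := by exact_mod_cast hk3.le

/-- Under the horizon condition in the direction of one block of coordinates, the partial
minimum over that block is attained. -/
theorem exists_forall_le_update_of_hor_pos {T : ℕ} {n : Fin (T+1) → ℕ} (t : Fin (T+1))
    {g : Strat T n → EReal} (hg : LowerSemicontinuous g)
    (hhor : ∀ ξ : Fin (n t) → ℝ, ξ ≠ 0 → 0 < hor g (Function.update (0 : Strat T n) t ξ))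
    (x : Strat T n) :
    ∃ ξ, ∀ η, g (Function.update x t ξ) ≤ g (Function.update x t η) := by
  set G : (Fin (n t) → ℝ) → EReal := fun ξ => g (Function.update x t ξ) with hG
  have hGlsc : LowerSemicontinuous G :=
    hg.comp (continuous_const.update t continuous_id)
  by_cases htop : ∀ ξ, G ξ = ⊤
  · exact ⟨0, fun η => by rw [show g _ = ⊤ from htop η]; exact le_top⟩
  push Not at htop
  obtain ⟨ξ₀, hξ₀⟩ := htop
  obtain ⟨a, ha⟩ : ∃ a : ℝ, G ξ₀ ≤ a := ⟨(G ξ₀).toReal, EReal.le_coe_toReal hξ₀⟩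
  have hbdd : Bornology.IsBounded {ξ | G ξ ≤ a} := by
    by_contra hnb
    have hex : ∀ k : ℕ, ∃ ξ, G ξ ≤ a ∧ (k : ℝ) + 1 < ‖ξ‖ := by
      intro k
      by_contra! hno
      exact hnb (isBounded_iff_forall_norm_le.2 ⟨_, hno⟩)
    choose ξ hξ hξn using hex
    have hpos : ∀ k, 0 < ‖ξ k‖ := fun k => lt_trans (by positivity) (hξn k)
    have hsph : ∀ k, ‖ξ k‖⁻¹ • ξ k ∈ sphere (0 : Fin (n t) → ℝ) 1 := fun k => by
      rw [mem_sphere_zero_iff_norm, norm_smul, norm_inv, norm_norm,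
        inv_mul_cancel₀ (hpos k).ne']
    obtain ⟨ζ, hζ, φ, hφ, hlim⟩ := (isCompact_sphere _ _).tendsto_subseq hsph
    have hζ0 : ζ ≠ 0 := by
      rintro rfl
      simp at hζ
    have hinf : Tendsto (fun k => ‖ξ k‖) atTop atTop :=
      tendsto_atTop_mono (fun k => (hξn k).le)
        (tendsto_atTop_add_const_right _ _ tendsto_natCast_atTop_atTop)
    have hl0 : Tendsto (fun k => ‖ξ (φ k)‖⁻¹) atTop (𝓝 0) :=
      tendsto_inv_atTop_zero.comp (hinf.comp hφ.tendsto_atTop)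
    refine (hhor ζ hζ0).not_ge (hor_nonpos_of_tendsto
      (fun k => Function.update x t (ξ (φ k))) (fun k => ‖ξ (φ k)‖⁻¹)
      (fun k => inv_pos.2 (hpos _)) hl0 ?_ (fun k => hξ (φ k)))
    have heq : ∀ k, ‖ξ (φ k)‖⁻¹ • Function.update x t (ξ (φ k)) =
        Function.update (‖ξ (φ k)‖⁻¹ • x) t (‖ξ (φ k)‖⁻¹ • ξ (φ k)) :=
      fun k => (Function.update_smul _ _ _ _).symm
    simp_rw [heq]
    have hx0 : Tendsto (fun k => ‖ξ (φ k)‖⁻¹ • x) atTop (𝓝 0) := by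
      simpa using hl0.smul_const x
    exact hx0.update t hlim
  have hcl : IsClosed {ξ | G ξ ≤ a} := hGlsc.isClosed_preimage a
  have hcomp : IsCompact {ξ | G ξ ≤ a} := isCompact_of_isClosed_isBounded hcl hbdd
  obtain ⟨ξ, hξ, hmin⟩ := (hGlsc.lowerSemicontinuousOn _).exists_isMinOn ⟨ξ₀, ha⟩ hcomp
  refine ⟨ξ, fun η => ?_⟩
  by_cases hη : G η ≤ a
  · exact hmin hη
  · exact le_trans hξ (not_le.1 hη).le

/-- Freezing the coordinates after time `t` of an adapted strategy gives an `F t`-measurable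
strategy. -/
theorem measurable_truncate {Ω : Type*} {T : ℕ} {n : Fin (T+1) → ℕ}
    {F : Fin (T+1) → MeasurableSpace Ω} (hF : ∀ s t : Fin (T+1), s ≤ t → F s ≤ F t)
    {x : Ω → Strat T n} (hx : ∀ t, Measurable[F t] fun ω => x ω t) (t : Fin (T+1)) :
    Measurable[F t] fun ω => (fun s => if s ≤ t then x ω s else 0 : Strat T n) := by
  refine @measurable_pi_lambda _ _ _ (F t) _ _ fun s => ?_
  by_cases hs : s ≤ t
  · simpa [hs] using (hx s).mono (hF s t hs) le_rfl
  · simp [hs]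

/-- Nonanticipative minimizers of an `F t`-measurable integrand in its `t`-th block. -/
theorem exists_measurable_ae_forall_le_update {Ω : Type*} {m0 : MeasurableSpace Ω}
    (μ : Measure Ω) [IsFiniteMeasure μ] {T : ℕ} {n : Fin (T+1) → ℕ} {m : MeasurableSpace Ω}
    (hm : m ≤ m0) (t : Fin (T+1)) {g : Strat T n → Ω → EReal}
    (hg : Measurable[(inferInstance : MeasurableSpace (Strat T n)).prod m]
      fun p : Strat T n × Ω => g p.1 p.2)
    (hlsc : ∀ ω, LowerSemicontinuous fun x => g x ω)
    (hhor : ∀ᵐ ω ∂μ, ∀ ξ : Fin (n t) → ℝ, ξ ≠ 0 →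
      0 < hor (fun x => g x ω) (Function.update (0 : Strat T n) t ξ))
    {x : Ω → Strat T n} (hx : Measurable[m] x) :
    ∃ s : Ω → Fin (n t) → ℝ, Measurable[m] s ∧ ∀ᵐ ω ∂μ, ∀ η,
      g (Function.update (x ω) t (s ω)) ω ≤ g (Function.update (x ω) t η) ω := by
  have hupd : Measurable[m.prod inferInstance] fun p : Ω × (Fin (n t) → ℝ) =>
      (Function.update (x p.1) t p.2, p.1) := by
    refine Measurable.prodMk (measurable_pi_lambda _ fun r => ?_) measurable_fst
    by_cases hr : r = t
    · subst hr
      simpa using measurable_snd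
    · simp only [Function.update_of_ne hr]
      exact (measurable_pi_apply r).comp (hx.comp measurable_fst)
  obtain ⟨s, hs, h⟩ := exists_measurable_argmin (μ.trim hm) (hg.comp hupd)
  refine ⟨s, hs, ?_⟩
  filter_upwards [ae_of_ae_trim hm h, hhor] with ω h1 h2
  obtain ⟨ξ, hξ⟩ := exists_forall_le_update_of_hor_pos t (hlsc ω) h2 (x ω)
  exact h1 ξ hξ

/-- existence of optimal solutions in the dynamic programming framework
under the horizon condition on the conditional integrands h_t. -/
theorem dp_existence
    {Ω : Type*} {m0 : MeasurableSpace Ω} (μ : Measure Ω) [IsProbabilityMeasure μ]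
    (hcomp : μ.IsComplete)
    (T : ℕ) (n : Fin (T+1) → ℕ)
    (F : Fin (T+1) → MeasurableSpace Ω)
    (hFmono : ∀ s t : Fin (T+1), s ≤ t → F s ≤ F t) (hFle : ∀ t, F t ≤ m0)
    -- the objective h : an F-normal integrand bounded below by an integrable function
    (h : Strat T n → Ω → EReal)
    (hmeas : Measurable fun p : Strat T n × Ω => h p.1 p.2)
    (hlsc : ∀ ω, LowerSemicontinuous fun x => h x ω)
    (m : Ω → ℝ) (hm : Integrable m μ) (hbd : ∀ x ω, (m ω : EReal) ≤ h x ω)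
    -- the dynamic programming family h_t, h̃_t of F_t-normal integrands
    (ht hts : Fin (T+1) → Strat T n → Ω → EReal)
    (htmeas : ∀ t, Measurable[(inferInstance : MeasurableSpace (Strat T n)).prod (F t)]
      fun p : Strat T n × Ω => ht t p.1 p.2)
    (htsmeas : ∀ t, Measurable[(inferInstance : MeasurableSpace (Strat T n)).prod (F t)]
      fun p : Strat T n × Ω => hts t p.1 p.2)
    (htlsc : ∀ t ω, LowerSemicontinuous fun x => ht t x ω)
    (htslsc : ∀ t ω, LowerSemicontinuous fun x => hts t x ω)
    (htdep : ∀ t (x y : Strat T n) ω, (∀ s, s ≤ t → x s = y s) → ht t x ω = ht t y ω)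
    (htsdep : ∀ t (x y : Strat T n) ω, (∀ s, s ≤ t → x s = y s) → hts t x ω = hts t y ω)
    (htbd : ∀ t, ∃ mt : Ω → ℝ, Integrable mt μ ∧ ∀ x ω, (mt ω : EReal) ≤ ht t x ω)
    (htsbd : ∀ t, ∃ mt : Ω → ℝ, Integrable mt μ ∧ ∀ x ω, (mt ω : EReal) ≤ hts t x ω)
    -- the recursion: h̃_T = h, h_t is a conditional integrand of h̃_t, and
    -- h̃_{t-1} is the inf-projection of h_t
    (hT : hts (Fin.last T) = h)
    (hcond : ∀ t (x : Ω → Strat T n), Measurable[F t] x → ∀ A : Set Ω, MeasurableSet[F t] A →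
      eInt (μ.restrict A) (fun ω => ht t (x ω) ω)
        = eInt (μ.restrict A) (fun ω => hts t (x ω) ω))
    (hrec : ∀ (t : ℕ) (hlt : t < T) (x : Strat T n) (ω : Ω),
      hts ⟨t, lt_trans hlt (Nat.lt_succ_self T)⟩ x ω
        = ⨅ ξ : Fin (n ⟨t+1, Nat.succ_lt_succ hlt⟩) → ℝ,
            ht ⟨t+1, Nat.succ_lt_succ hlt⟩ (Function.update x ⟨t+1, Nat.succ_lt_succ hlt⟩ ξ) ω)
    -- the horizon condition
    (hhor : ∀ t : Fin (T+1), ∀ᵐ ω ∂μ, ∀ ξ : Fin (n t) → ℝ, ξ ≠ 0 →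
      0 < hor (fun x => ht t x ω) (Function.update (0 : Strat T n) t ξ)) :
    -- conclusion: an optimal adapted strategy exists
    ∃ x : (t : Fin (T+1)) → Ω → Fin (n t) → ℝ, (∀ t, Measurable[F t] (x t)) ∧
      eInt μ (fun ω => h (fun t => x t ω) ω)
        = ⨅ (x' : (t : Fin (T+1)) → Ω → Fin (n t) → ℝ)
            (_ : ∀ t, Measurable[F t] (x' t)),
            eInt μ (fun ω => h (fun t => x' t ω) ω) := by
  classical
  have hdep_update : ∀ t (x y : Strat T n) (η : Fin (n t) → ℝ) ω, (∀ s, s < t → x s = y s) →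
      ht t (Function.update x t η) ω = ht t (Function.update y t η) ω := by
    intro t x y η ω hxy
    refine htdep t _ _ ω fun s hs => ?_
    rcases hs.eq_or_lt with rfl | hs
    · simp
    · simp [hs.ne, hxy s hs]
  have hcond' : ∀ t (x : Ω → Strat T n), (∀ s, Measurable[F s] fun ω => x ω s) →
      eInt μ (fun ω => ht t (x ω) ω) = eInt μ (fun ω => hts t (x ω) ω) := by
    intro t x hx
    have := hcond t _ (measurable_truncate hFmono hx t) univ MeasurableSet.univ
    rw [Measure.restrict_univ] at this
    have h1 : ∀ ω, ∀ s ≤ t, (fun s => if s ≤ t then x ω s else 0 : Strat T n) s = x ω s :=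
      fun ω s hs => if_pos hs
    simpa only [fun ω => htdep t _ _ ω (h1 ω), fun ω => htsdep t _ _ ω (h1 ω)] using this
  have hexists : ∀ k ≤ T + 1, ∃ x : Ω → Strat T n, (∀ t, Measurable[F t] fun ω => x ω t) ∧
      ∀ t : Fin (T+1), t.val < k → ∀ᵐ ω ∂μ, ∀ η,
        ht t (x ω) ω ≤ ht t (Function.update (x ω) t η) ω := by
    intro k hk
    induction k with
    | zero => exact ⟨fun _ => 0, fun t => measurable_const, fun t h => absurd h (Nat.not_lt_zero _)⟩
    | succ k ih =>
      obtain ⟨x, hx, hopt⟩ := ih (by lia)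
      set t : Fin (T+1) := ⟨k, hk⟩
      obtain ⟨s, hs, hmin⟩ := exists_measurable_ae_forall_le_update μ (hFle t) t (htmeas t)
        (htlsc t) (hhor t) (measurable_truncate hFmono hx t)
      refine ⟨fun ω => Function.update (x ω) t (s ω), fun r => ?_, fun r hr => ?_⟩
      · by_cases hrt : r = t
        · subst hrt
          simpa using hs
        · simpa [hrt] using hx r
      · rcases Nat.lt_succ_iff_lt_or_eq.1 hr with hlt | heq
        · have hrt : r < t := hlt
          filter_upwards [hopt r hlt] with ω h η
          have e1 : ht r (Function.update (x ω) t (s ω)) ω = ht r (x ω) ω :=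
            htdep r _ _ ω fun q hq => by simp [(hq.trans_lt hrt).ne]
          rw [e1, hdep_update r _ (x ω) η ω fun q hq => by simp [(hq.trans hrt).ne]]
          exact h η
        · obtain rfl : r = t := Fin.ext heq
          filter_upwards [hmin] with ω h η
          have e : ∀ ζ, ht t (Function.update
              (fun s => if s ≤ t then x ω s else 0 : Strat T n) t ζ) ω =
              ht t (Function.update (x ω) t ζ) ω :=
            fun ζ => hdep_update t _ _ ζ ω fun q hq => if_pos hq.le
          rw [Function.update_idem, ← e, ← e]
          exact h η
  obtain ⟨x, hx, hopt⟩ := hexists (T + 1) le_rfl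
  have hopt' : ∀ t, ∀ᵐ ω ∂μ, ∀ η, ht t (x ω) ω ≤ ht t (Function.update (x ω) t η) ω :=
    fun t => hopt t t.2
  have hle : ∀ y : Ω → Strat T n, (∀ t, Measurable[F t] fun ω => y ω t) →
      ∀ (k : ℕ) (hk : k < T + 1),
        eInt μ (fun ω => hts ⟨k, hk⟩ (x ω) ω) ≤ eInt μ (fun ω => hts ⟨k, hk⟩ (y ω) ω) := by
    intro y hy k
    induction k with
    | zero =>
      intro hk
      rw [← hcond' _ x hx, ← hcond' _ y hy]
      refine eInt_mono_ae ((hopt' ⟨0, hk⟩).mono fun ω h => (h (y ω ⟨0, hk⟩)).trans_eq ?_)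
      refine htdep _ _ _ ω fun s hs => ?_
      obtain rfl : s = ⟨0, hk⟩ := le_antisymm hs (Fin.zero_le s)
      simp
    | succ k ih =>
      intro hk
      have hkT : k < T := Nat.lt_of_succ_lt_succ hk
      calc eInt μ (fun ω => hts ⟨k + 1, hk⟩ (x ω) ω)
          = eInt μ (fun ω => ht ⟨k + 1, hk⟩ (x ω) ω) := (hcond' _ x hx).symm
        _ ≤ eInt μ (fun ω => hts ⟨k, _⟩ (x ω) ω) :=
            eInt_mono_ae ((hopt' ⟨k + 1, hk⟩).mono fun ω h => by
              rw [hrec k hkT]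
              exact le_iInf h)
        _ ≤ eInt μ (fun ω => hts ⟨k, _⟩ (y ω) ω) := ih _
        _ ≤ eInt μ (fun ω => ht ⟨k + 1, hk⟩ (y ω) ω) :=
            eInt_mono_ae (ae_of_all _ fun ω => by
              rw [hrec k hkT]
              refine (iInf_le _ (y ω ⟨k + 1, hk⟩)).trans_eq ?_
              rw [Function.update_eq_self])
        _ = eInt μ (fun ω => hts ⟨k + 1, hk⟩ (y ω) ω) := hcond' _ y hy
  refine ⟨fun t ω => x ω t, hx, le_antisymm (le_iInf₂ fun y hy => ?_)
    (iInf₂_le (fun t ω => x ω t) hx)⟩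
  have := hle (fun ω t => y t ω) hy T (Nat.lt_succ_self T)
  rwa [show (⟨T, Nat.lt_succ_self T⟩ : Fin (T+1)) = Fin.last T from rfl, hT] at this

end
end

section
/- Let (Ω, F, (F_t)_{t=0}^T, P) be a complete filtered probability space and h an F-normal integrand on ℝⁿ × Ω with h ≥ m for an integrable m. Assume there exists a measurable set-valued mapping N̂ : Ω ⇉ ℝⁿ whose values are linear subspaces of ℝⁿ such that {x ∈ N : h^∞(x(ω),ω) ≤ 0 P-a.s.} = {x ∈ N : x(ω) ∈ N̂(ω) P-a.s.}, and such that Eh(x + x′) = Eh(x) for all x, x′ ∈ N with x′(ω) ∈ N̂(ω) P-a.s. Then the problem of minimizing Eh(x) over x ∈ N admits an optimal solution. -/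
open Filter MeasureTheory Metric Set
open scoped Topology ENNReal

noncomputable section

section Selection

variable {Ω : Type*} {m : MeasurableSpace Ω}

theorem measurable_apply_index {β : Type*} [MeasurableSpace β] {f : ℕ → Ω → β}
    (hf : ∀ k, Measurable (f k)) {κ : Ω → ℕ} (hκ : Measurable κ) :
    Measurable fun ω => f (κ ω) ω :=
  (measurable_from_prod_countable_right (f := fun p : ℕ × Ω => f p.1 p.2) hf).comp
    (hκ.prodMk measurable_id)

theorem exists_measurable_index {P : ℕ → ℕ → Ω → Prop}
    (hP : ∀ k i, MeasurableSet {ω | P k i ω}) (h : ∀ k ω, ∃ᶠ i in atTop, P k i ω) :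
    ∃ κ : ℕ → Ω → ℕ, (∀ k, Measurable (κ k)) ∧ (∀ k ω, k ≤ κ k ω) ∧ ∀ k ω, P k (κ k ω) ω := by
  classical
  have hex : ∀ k ω, ∃ i, k ≤ i ∧ P k i ω := fun k ω => by
    obtain ⟨i, hi, hPi⟩ := frequently_atTop.1 (h k ω) k
    exact ⟨i, hi, hPi⟩
  refine ⟨fun k ω => Nat.find (hex k ω), fun k => ?_, fun k ω => (Nat.find_spec (hex k ω)).1,
    fun k ω => (Nat.find_spec (hex k ω)).2⟩
  exact measurable_find (hex k) fun i => (MeasurableSet.const _).inter (hP k i)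

theorem exists_measurable_index_le_liminf {f : ℕ → Ω → ℝ≥0∞} (hf : ∀ k, Measurable (f k)) :
    ∃ κ : ℕ → Ω → ℕ, (∀ k, Measurable (κ k)) ∧ (∀ k ω, k ≤ κ k ω) ∧
      ∀ k ω, f (κ k ω) ω ≤ liminf (fun i => f i ω) atTop + ((k : ℝ≥0∞) + 1)⁻¹ := by
  refine exists_measurable_index
    (P := fun k i ω => f i ω ≤ liminf (fun i => f i ω) atTop + ((k : ℝ≥0∞) + 1)⁻¹) ?_ ?_
  · intro k i
    exact measurableSet_le (hf i) ((Measurable.liminf hf).add measurable_const)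
  · intro k ω
    by_cases htop : liminf (fun i => f i ω) atTop = ⊤
    · exact Frequently.of_forall fun i => by simp [htop]
    · have hlt : liminf (fun i => f i ω) atTop
          < liminf (fun i => f i ω) atTop + ((k : ℝ≥0∞) + 1)⁻¹ :=
        ENNReal.lt_add_right htop (by simp)
      exact (frequently_lt_of_liminf_lt (by isBoundedDefault) hlt).mono fun i hi => hi.le

theorem exists_measurable_index_tendsto_real {v : ℕ → Ω → ℝ} (hv : ∀ k, Measurable (v k))
    (hb : ∀ ω, ∃ R, ∀ k, |v k ω| ≤ R) :
    ∃ κ : ℕ → Ω → ℕ, (∀ k, Measurable (κ k)) ∧ (∀ k ω, k ≤ κ k ω) ∧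
      ∃ z : Ω → ℝ, Measurable z ∧ ∀ ω, Tendsto (fun k => v (κ k ω) ω) atTop (𝓝 (z ω)) := by
  have hz : Measurable fun ω => liminf (fun i => v i ω) atTop := Measurable.liminf hv
  obtain ⟨κ, hκ, hκk, hP⟩ := exists_measurable_index
    (P := fun k i ω => dist (v i ω) (liminf (fun i => v i ω) atTop) ≤ 1 / ((k : ℝ) + 1)) (by
      intro k i
      exact measurableSet_le ((hv i).dist hz) measurable_const) (by
      intro k ω
      obtain ⟨R, hR⟩ := hb ω
      have hpos : 0 < 1 / ((k : ℝ) + 1) := by positivity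
      have hb1 : IsBoundedUnder (· ≥ ·) atTop (fun i => v i ω) :=
        isBoundedUnder_of ⟨-R, fun i => (abs_le.1 (hR i)).1⟩
      have hb2 : IsBoundedUnder (· ≤ ·) atTop (fun i => v i ω) :=
        isBoundedUnder_of ⟨R, fun i => (abs_le.1 (hR i)).2⟩
      have h1 := frequently_lt_of_liminf_lt (u := fun i => v i ω) hb2.isCoboundedUnder_ge
        (lt_add_of_pos_right (liminf (fun i => v i ω) atTop) hpos)
      have h2 := eventually_lt_of_lt_liminf (u := fun i => v i ω)
        (sub_lt_self (liminf (fun i => v i ω) atTop) hpos) hb1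
      refine (h1.and_eventually h2).mono fun i hi => ?_
      rw [Real.dist_eq, abs_le]
      constructor <;> linarith [hi.1, hi.2])
  refine ⟨κ, hκ, hκk, _, hz, fun ω => ?_⟩
  exact tendsto_iff_dist_tendsto_zero.2 (squeeze_zero (fun _ => dist_nonneg) (fun k => hP k ω)
    tendsto_one_div_add_atTop_nhds_zero_nat)

theorem exists_measurable_index_tendsto {ι : Type*} [Fintype ι] {v : ℕ → Ω → ι → ℝ}
    (hv : ∀ k, Measurable (v k)) (hb : ∀ ω, ∃ R, ∀ k, ‖v k ω‖ ≤ R) :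
    ∃ κ : ℕ → Ω → ℕ, (∀ k, Measurable (κ k)) ∧ (∀ k ω, k ≤ κ k ω) ∧
      ∃ z : Ω → ι → ℝ, Measurable z ∧ ∀ ω, Tendsto (fun k => v (κ k ω) ω) atTop (𝓝 (z ω)) := by
  classical
  suffices H : ∀ S : Finset ι, ∃ κ : ℕ → Ω → ℕ, (∀ k, Measurable (κ k)) ∧ (∀ k ω, k ≤ κ k ω) ∧
      ∃ z : Ω → ι → ℝ, Measurable z ∧
        ∀ ω, ∀ i ∈ S, Tendsto (fun k => v (κ k ω) ω i) atTop (𝓝 (z ω i)) by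
    obtain ⟨κ, hκ, hκk, z, hz, hlim⟩ := H Finset.univ
    exact ⟨κ, hκ, hκk, z, hz, fun ω => tendsto_pi_nhds.2 fun i => hlim ω i (Finset.mem_univ i)⟩
  intro S
  induction S using Finset.induction_on with
  | empty =>
    exact ⟨fun k _ => k, fun k => measurable_const, fun k _ => le_rfl, 0, measurable_const, by simp⟩
  | insert a S ha ih =>
    obtain ⟨κ, hκ, hκk, z, hz, hlim⟩ := ih
    obtain ⟨κ', hκ', hκk', y, hy, hylim⟩ := exists_measurable_index_tendsto_real
      (v := fun k ω => v (κ k ω) ω a)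
      (fun k => (measurable_pi_apply a).comp (measurable_apply_index hv (hκ k)))
      (fun ω => by
        obtain ⟨R, hR⟩ := hb ω
        exact ⟨R, fun k => (norm_le_pi_norm (v (κ k ω) ω) a).trans (hR _)⟩)
    refine ⟨fun k ω => κ (κ' k ω) ω, fun k => measurable_apply_index hκ (hκ' k),
      fun k ω => (hκk' k ω).trans (hκk _ ω), fun ω => Function.update (z ω) a (y ω), ?_, ?_⟩
    · refine measurable_pi_iff.2 fun i => ?_
      by_cases hi : i = a
      · subst hi; simpa using hy
      · simpa [hi] using measurable_pi_iff.1 hz i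
    · intro ω i hi
      by_cases hia : i = a
      · subst hia; simpa using hylim ω
      · have hiS : i ∈ S := (Finset.mem_insert.1 hi).resolve_left hia
        simpa [hia, Function.comp_def] using
          (hlim ω i hiS).comp (tendsto_atTop_mono (fun k => hκk' k ω) tendsto_id)

end Selection

section Conditional

variable {Ω : Type*} {m m0 : MeasurableSpace Ω} {μ : Measure Ω}

theorem lintegral_mul_eq_of_setLIntegral_eq (hm : m ≤ m0) {a b : Ω → ℝ≥0∞}
    (ha : Measurable a) (hb : Measurable b)
    (hab : ∀ A, MeasurableSet[m] A → ∫⁻ ω in A, a ω ∂μ = ∫⁻ ω in A, b ω ∂μ)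
    {l : Ω → ℝ≥0∞} (hl : Measurable[m] l) :
    ∫⁻ ω, l ω * a ω ∂μ = ∫⁻ ω, l ω * b ω ∂μ := by
  have key : (μ.withDensity a).trim hm = (μ.withDensity b).trim hm := by
    refine @Measure.ext _ m _ _ fun A hA => ?_
    rw [trim_measurableSet_eq hm hA, trim_measurableSet_eq hm hA, withDensity_apply _ (hm A hA),
      withDensity_apply _ (hm A hA), hab A hA]
  have hl0 : Measurable l := hl.mono hm le_rfl
  have h1 := lintegral_withDensity_eq_lintegral_mul μ ha hl0
  have h2 := lintegral_withDensity_eq_lintegral_mul μ hb hl0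
  rw [← lintegral_trim hm hl, key, lintegral_trim hm hl] at h1
  simp only [Pi.mul_apply, mul_comm (a _), mul_comm (b _)] at h1 h2
  rw [← h1, h2]

theorem lintegral_mul_apply_index_eq (hm : m ≤ m0) {a b : ℕ → Ω → ℝ≥0∞}
    (ha : ∀ i, Measurable (a i)) (hb : ∀ i, Measurable (b i))
    (hab : ∀ i A, MeasurableSet[m] A → ∫⁻ ω in A, a i ω ∂μ = ∫⁻ ω in A, b i ω ∂μ)
    {l : Ω → ℝ≥0∞} (hl : Measurable[m] l) {τ : Ω → ℕ} (hτ : Measurable[m] τ) :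
    ∫⁻ ω, l ω * a (τ ω) ω ∂μ = ∫⁻ ω, l ω * b (τ ω) ω ∂μ := by
  have hset : ∀ i, MeasurableSet[m] {ω | τ ω = i} := fun i => hτ (measurableSet_singleton i)
  have hli : ∀ i, Measurable[m] ({ω | τ ω = i}.indicator l) := fun i => hl.indicator (hset i)
  have expand : ∀ c : ℕ → Ω → ℝ≥0∞, (∀ i, Measurable (c i)) →
      ∫⁻ ω, l ω * c (τ ω) ω ∂μ = ∑' i, ∫⁻ ω, {ω | τ ω = i}.indicator l ω * c i ω ∂μ := by
    intro c hc
    refine Eq.trans ?_ (lintegral_tsum (μ := μ)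
      (f := fun i ω => {ω | τ ω = i}.indicator l ω * c i ω)
      fun i => (((hli i).mono hm le_rfl).mul (hc i)).aemeasurable)
    refine lintegral_congr fun ω => ?_
    rw [tsum_eq_single (τ ω) fun i hi => by simp [Set.indicator, hi.symm]]
    simp [Set.indicator]
  rw [expand a ha, expand b hb]
  exact tsum_congr fun i => lintegral_mul_eq_of_setLIntegral_eq hm (ha i) (hb i) (hab i) (hli i)

theorem setLIntegral_liminf_le [IsProbabilityMeasure μ] (hm : m ≤ m0) {a b : ℕ → Ω → ℝ≥0∞}
    (ha : ∀ i, Measurable (a i)) (hb : ∀ i, Measurable (b i))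
    (hab : ∀ i A, MeasurableSet[m] A → ∫⁻ ω in A, a i ω ∂μ = ∫⁻ ω in A, b i ω ∂μ)
    {l : ℕ → Ω → ℝ≥0∞} (hl : ∀ k, Measurable[m] (l k))
    {τ : ℕ → Ω → ℕ} (hτ : ∀ k, Measurable[m] (τ k)) {C : Ω → ℝ≥0∞}
    (hC : ∀ k : ℕ, ∀ᵐ ω ∂μ, l k ω * a (τ k ω) ω ≤ C ω + ((k : ℝ≥0∞) + 1)⁻¹)
    {A : Set Ω} (hA : MeasurableSet[m] A) :
    ∫⁻ ω in A, liminf (fun k => l k ω * b (τ k ω) ω) atTop ∂μ ≤ ∫⁻ ω in A, C ω ∂μ := by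
  have hlb : ∀ k, Measurable fun ω => l k ω * b (τ k ω) ω := fun k =>
    ((hl k).mono hm le_rfl).mul (measurable_apply_index hb ((hτ k).mono hm le_rfl))
  have step : ∀ k : ℕ, ∫⁻ ω in A, l k ω * b (τ k ω) ω ∂μ
      ≤ ∫⁻ ω in A, C ω ∂μ + ((k : ℝ≥0∞) + 1)⁻¹ := by
    intro k
    have hind : ∀ c : ℕ → Ω → ℝ≥0∞, ∫⁻ ω in A, l k ω * c (τ k ω) ω ∂μ
        = ∫⁻ ω, A.indicator (l k) ω * c (τ k ω) ω ∂μ := fun c => by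
      rw [← lintegral_indicator (hm A hA)]
      refine lintegral_congr fun ω => ?_
      by_cases hω : ω ∈ A <;> simp [hω]
    have h1 := lintegral_mul_apply_index_eq hm ha hb hab ((hl k).indicator hA) (hτ k)
    rw [← hind, ← hind] at h1
    rw [← h1]
    calc ∫⁻ ω in A, l k ω * a (τ k ω) ω ∂μ ≤ ∫⁻ ω in A, (C ω + ((k : ℝ≥0∞) + 1)⁻¹) ∂μ :=
          lintegral_mono_ae (ae_restrict_of_ae (hC k))
      _ = ∫⁻ ω in A, C ω ∂μ + ((k : ℝ≥0∞) + 1)⁻¹ * μ A := by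
          rw [lintegral_add_right _ measurable_const, setLIntegral_const]
      _ ≤ _ := by
          gcongr
          exact mul_le_of_le_one_right' prob_le_one
  refine (lintegral_liminf_le hlb).trans ?_
  have hlim : Tendsto (fun k : ℕ => ∫⁻ ω in A, C ω ∂μ + ((k : ℝ≥0∞) + 1)⁻¹) atTop
      (𝓝 (∫⁻ ω in A, C ω ∂μ + 0)) := by
    refine tendsto_const_nhds.add ?_
    have := (tendsto_add_atTop_iff_nat 1).2 ENNReal.tendsto_inv_nat_nhds_zero
    simpa using this
  rw [add_zero] at hlim
  exact (liminf_le_liminf (Eventually.of_forall step)).trans hlim.liminf_eq.le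

theorem ae_lt_top_of_setLIntegral_le [IsFiniteMeasure μ] (hm : m ≤ m0) {C D : Ω → ℝ≥0∞}
    (hC : Measurable[m] C) (hD : Measurable D) (hfin : ∀ᵐ ω ∂μ, C ω < ⊤)
    (h : ∀ A, MeasurableSet[m] A → ∫⁻ ω in A, D ω ∂μ ≤ ∫⁻ ω in A, C ω ∂μ) :
    ∀ᵐ ω ∂μ, D ω < ⊤ := by
  have key : ∀ N : ℕ, ∀ᵐ ω ∂μ, C ω ≤ N → D ω < ⊤ := by
    intro N
    have hA : MeasurableSet[m] {ω | C ω ≤ N} := hC measurableSet_Iic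
    refine (ae_restrict_iff' (hm _ hA)).1 ?_
    refine ae_lt_top hD (((h _ hA).trans_lt ?_).ne)
    calc ∫⁻ ω in {ω | C ω ≤ N}, C ω ∂μ ≤ ∫⁻ _ in {ω | C ω ≤ N}, (N : ℝ≥0∞) ∂μ :=
          setLIntegral_mono' (hm _ hA) fun ω hω => hω
      _ = N * μ {ω | C ω ≤ N} := setLIntegral_const _ _
      _ < ⊤ := ENNReal.mul_lt_top (ENNReal.natCast_lt_top N) (measure_lt_top μ _)
  filter_upwards [hfin, ae_all_iff.2 key] with ω h1 h2
  obtain ⟨N, hN⟩ := ENNReal.exists_nat_gt h1.ne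
  exact h2 N hN.le

end Conditional

section AdaptedLimit

variable {Ω : Type*} {m0 : MeasurableSpace Ω} {μ : Measure Ω} {T : ℕ} {n : Fin (T + 1) → ℕ}
  {𝓖 : ℕ → MeasurableSpace Ω} {X : ℕ → (s : Fin (T + 1)) → Ω → Fin (n s) → ℝ}
  {G : ℕ → Ω → ℝ≥0∞} {c : ℕ → ℕ → Ω → ℝ≥0∞}

/-- Scaled and randomly indexed strategies `l k • X (τ k)`, with `l k` and `τ k` known at time `j`,
whose coordinates before time `j` converge and whose scaled conditional costs `l k * c (τ k) j` are
asymptotically below a finite `C`, have pointwise subsequences converging to an adapted strategy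
along which the scaled cost is asymptotically below some `D` with conditional expectation at
most `C`. -/
def LimitProperty (μ : Measure Ω) (𝓖 : ℕ → MeasurableSpace Ω)
    (X : ℕ → (s : Fin (T + 1)) → Ω → Fin (n s) → ℝ)
    (G : ℕ → Ω → ℝ≥0∞) (c : ℕ → ℕ → Ω → ℝ≥0∞) (j : ℕ) : Prop :=
  ∀ (l : ℕ → Ω → ℝ) (τ : ℕ → Ω → ℕ) (z : (s : Fin (T + 1)) → Ω → Fin (n s) → ℝ) (C : Ω → ℝ≥0∞),
    (∀ k, Measurable[𝓖 j] (l k)) → (∀ k, Measurable[𝓖 j] (τ k)) →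
    (∀ k ω, 0 < l k ω) → (∀ k ω, l k ω ≤ 1) →
    (∀ s : Fin (T + 1), Measurable[𝓖 (s + 1)] (z s)) →
    (∀ᵐ ω ∂μ, ∀ s : Fin (T + 1), (s : ℕ) < j →
      Tendsto (fun k => l k ω • X (τ k ω) s ω) atTop (𝓝 (z s ω))) →
    Measurable[𝓖 j] C → (∀ᵐ ω ∂μ, C ω < ⊤) →
    (∀ k : ℕ, ∀ᵐ ω ∂μ,
      ENNReal.ofReal (l k ω) * c (τ k ω) j ω ≤ C ω + ((k : ℝ≥0∞) + 1)⁻¹) →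
    ∃ (z' : (s : Fin (T + 1)) → Ω → Fin (n s) → ℝ) (D : Ω → ℝ≥0∞),
      (∀ s : Fin (T + 1), Measurable[𝓖 (s + 1)] (z' s)) ∧
      (∀ s : Fin (T + 1), (s : ℕ) < j → z' s = z s) ∧
      Measurable D ∧
      (∀ A, MeasurableSet[𝓖 j] A → ∫⁻ ω in A, D ω ∂μ ≤ ∫⁻ ω in A, C ω ∂μ) ∧
      ∀ᵐ ω ∂μ, ∃ κ : ℕ → ℕ, Tendsto κ atTop atTop ∧
        (∀ s, Tendsto (fun k => l (κ k) ω • X (τ (κ k) ω) s ω) atTop (𝓝 (z' s ω))) ∧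
        ∀ k, ENNReal.ofReal (l (κ k) ω) * G (τ (κ k) ω) ω ≤ D ω + ((k : ℝ≥0∞) + 1)⁻¹

/-- Directions that arise from the sequence `X` by scaling to zero with vanishing scaled cost. -/
def IsRecessionDirection (X : ℕ → (s : Fin (T + 1)) → Ω → Fin (n s) → ℝ) (G : ℕ → Ω → ℝ≥0∞)
    (ω : Ω) (w : Strat T n) : Prop :=
  ∃ (l : ℕ → ℝ) (τ : ℕ → ℕ), (∀ k, 0 < l k) ∧ Tendsto l atTop (𝓝 0) ∧
    (∀ r, Tendsto (fun k => l k • X (τ k) r ω) atTop (𝓝 (w r))) ∧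
    ∀ k : ℕ, ENNReal.ofReal (l k) * G (τ k) ω ≤ ((k : ℝ≥0∞) + 1)⁻¹

/-- `X` is nearly minimal in norm at time `s` modulo adapted recession directions that vanish
before time `s`. -/
def NearlyReducedAt (μ : Measure Ω) (𝓖 : ℕ → MeasurableSpace Ω)
    (X : ℕ → (s : Fin (T + 1)) → Ω → Fin (n s) → ℝ) (G : ℕ → Ω → ℝ≥0∞) (s : Fin (T + 1)) : Prop :=
  ∀ w : (r : Fin (T + 1)) → Ω → Fin (n r) → ℝ, (∀ r : Fin (T + 1), Measurable[𝓖 (r + 1)] (w r)) →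
    (∀ r, r < s → w r = 0) →
    (∀ᵐ ω ∂μ, IsRecessionDirection X G ω (fun r => w r ω)) →
    ∀ ν, ∀ᵐ ω ∂μ, ‖X ν s ω‖ ≤ 2 * ‖X ν s ω - ‖X ν s ω‖ • w s ω‖ + 1

theorem limitProperty_horizon [IsProbabilityMeasure μ] (hle : ∀ j, 𝓖 j ≤ m0)
    (hG : ∀ ν, Measurable (G ν)) (hc : ∀ ν j, Measurable[𝓖 j] (c ν j))
    (hcG : ∀ ν j A, MeasurableSet[𝓖 j] A → ∫⁻ ω in A, c ν j ω ∂μ = ∫⁻ ω in A, G ν ω ∂μ) :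
    LimitProperty μ 𝓖 X G c (T + 1) := by
  intro l τ z C hl hτ hl0 hl1 hz hconv hC hCfin hCb
  have hf : ∀ k, Measurable fun ω => ENNReal.ofReal (l k ω) * G (τ k ω) ω := fun k =>
    ((hl k).mono (hle _) le_rfl).ennreal_ofReal.mul
      (measurable_apply_index hG ((hτ k).mono (hle _) le_rfl))
  refine ⟨z, fun ω => liminf (fun k => ENNReal.ofReal (l k ω) * G (τ k ω) ω) atTop, hz,
    fun _ _ => rfl, Measurable.liminf hf, fun A hA => ?_, ?_⟩
  · exact setLIntegral_liminf_le (hle (T + 1)) (a := fun i => c i (T + 1)) (b := G)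
      (l := fun k ω => ENNReal.ofReal (l k ω))
      (fun i => (hc i _).mono (hle _) le_rfl) hG (fun i => hcG i _)
      (fun k => (hl k).ennreal_ofReal) hτ hCb hA
  · obtain ⟨κ, -, hκk, hκf⟩ := exists_measurable_index_le_liminf hf
    filter_upwards [hconv] with ω hω
    have hκ : Tendsto (fun k => κ k ω) atTop atTop :=
      tendsto_atTop_mono (fun k => hκk k ω) tendsto_id
    exact ⟨fun k => κ k ω, hκ, fun s => (hω s s.2).comp hκ, fun k => hκf k ω⟩

theorem ae_liminf_enorm_lt_top [IsProbabilityMeasure μ]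
    (hX : ∀ ν (s : Fin (T + 1)), Measurable[𝓖 (s + 1)] (X ν s))
    (hc : ∀ ν j, Measurable[𝓖 j] (c ν j)) {s₀ : Fin (T + 1)}
    (hred : NearlyReducedAt μ 𝓖 X G s₀) (ih : LimitProperty μ 𝓖 X G c (s₀ + 1))
    {l : ℕ → Ω → ℝ} {τ : ℕ → Ω → ℕ} {z : (s : Fin (T + 1)) → Ω → Fin (n s) → ℝ} {C : Ω → ℝ≥0∞}
    (hl : ∀ k, Measurable[𝓖 (s₀ + 1)] (l k)) (hτ : ∀ k, Measurable[𝓖 (s₀ + 1)] (τ k))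
    (hl0 : ∀ k ω, 0 < l k ω) (hl1 : ∀ k ω, l k ω ≤ 1)
    (hconv : ∀ᵐ ω ∂μ, ∀ s : Fin (T + 1), s < s₀ →
      Tendsto (fun k => l k ω • X (τ k ω) s ω) atTop (𝓝 (z s ω)))
    (hCfin : ∀ᵐ ω ∂μ, C ω < ⊤)
    (hCb : ∀ k : ℕ, ∀ᵐ ω ∂μ,
      ENNReal.ofReal (l k ω) * c (τ k ω) (s₀ + 1) ω ≤ C ω + ((k : ℝ≥0∞) + 1)⁻¹) :
    ∀ᵐ ω ∂μ, liminf (fun k => ‖l k ω • X (τ k ω) s₀ ω‖ₑ) atTop < ⊤ := by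
  classical
  set v : ℕ → Ω → Fin (n s₀) → ℝ := fun k ω => l k ω • X (τ k ω) s₀ ω with hvdef
  have hv : ∀ k, Measurable[𝓖 (s₀ + 1)] (v k) := fun k =>
    (hl k).smul (measurable_apply_index (fun i => hX i s₀) (hτ k))
  set B : Set Ω := {ω | liminf (fun k => ‖v k ω‖ₑ) atTop = ⊤} with hBdef
  have hB : MeasurableSet[𝓖 (s₀ + 1)] B :=
    (Measurable.liminf fun k => measurable_enorm.comp (hv k)) (measurableSet_singleton ⊤)
  set ρ : ℕ → Ω → ℝ := fun k ω =>
    (if ω ∈ B then 1 else 1 / ((k : ℝ) + 1)) / (1 + ‖v k ω‖) with hρdef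
  have hρ : ∀ k, Measurable[𝓖 (s₀ + 1)] (ρ k) := fun k =>
    (Measurable.ite hB measurable_const measurable_const).div
      (measurable_const.add (measurable_norm.comp (hv k)))
  have hρ0 : ∀ k ω, 0 < ρ k ω := fun k ω => by
    simp only [hρdef]; split_ifs <;> positivity
  have hnum : ∀ (k : ℕ) ω, (if ω ∈ B then (1 : ℝ) else 1 / ((k : ℝ) + 1)) ≤ 1 := fun k ω => by
    split_ifs
    · exact le_rfl
    · rw [div_le_one (by positivity)]
      linarith [(Nat.cast_nonneg k : (0 : ℝ) ≤ k)]
  have hρv : ∀ k ω, ρ k ω * (1 + ‖v k ω‖) ≤ 1 := fun k ω => by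
    simp only [hρdef]
    rw [div_mul_cancel₀ _ (by positivity)]
    exact hnum k ω
  have hρ1 : ∀ k ω, ρ k ω ≤ 1 := fun k ω => by
    nlinarith [hρv k ω, hρ0 k ω, norm_nonneg (v k ω), mul_nonneg (hρ0 k ω).le (norm_nonneg (v k ω))]
  have hρlim : ∀ ω, Tendsto (fun k => ρ k ω) atTop (𝓝 0) := fun ω => by
    by_cases hω : ω ∈ B
    · have h1 : Tendsto (fun k => ‖v k ω‖ₑ) atTop (𝓝 ⊤) :=
        tendsto_of_le_liminf_of_limsup_le (le_of_eq (Eq.symm hω)) le_top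
      have h2 : Tendsto (fun k => ‖v k ω‖) atTop atTop := by
        refine tendsto_atTop.2 fun b => ?_
        filter_upwards [h1.eventually (lt_mem_nhds (ENNReal.ofReal_lt_top (r := b)))] with k hk
        rw [← ofReal_norm] at hk
        exact (ENNReal.lt_ofReal_iff_toReal_lt ENNReal.ofReal_ne_top).1 hk |>.le.trans' (by
          simp [ENNReal.toReal_ofReal'])
      have h3 := (tendsto_atTop_add_const_left _ (1 : ℝ) h2).inv_tendsto_atTop
      simpa [hρdef, hω, Pi.inv_def] using h3
    · refine squeeze_zero (fun k => (hρ0 k ω).le) (fun k => ?_)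
        tendsto_one_div_add_atTop_nhds_zero_nat
      simp only [hρdef, hω, if_false]
      exact div_le_self (by positivity) (by linarith [norm_nonneg (v k ω)])
  set l₂ : ℕ → Ω → ℝ := fun k ω => ρ k ω * l k ω with hl₂def
  have hl₂ : ∀ k, Measurable[𝓖 (s₀ + 1)] (l₂ k) := fun k => (hρ k).mul (hl k)
  have hl₂lim : ∀ ω, Tendsto (fun k => l₂ k ω) atTop (𝓝 0) := fun ω =>
    squeeze_zero (fun k => (mul_pos (hρ0 k ω) (hl0 k ω)).le)
      (fun k => mul_le_of_le_one_right (hρ0 k ω).le (hl1 k ω)) (hρlim ω)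
  have hf : ∀ k, Measurable[𝓖 (s₀ + 1)]
      fun ω => ENNReal.ofReal (l₂ k ω) * c (τ k ω) (s₀ + 1) ω := fun k =>
    (hl₂ k).ennreal_ofReal.mul (measurable_apply_index (fun i => hc i (s₀ + 1)) (hτ k))
  have hfliminf : ∀ᵐ ω ∂μ,
      liminf (fun k => ENNReal.ofReal (l₂ k ω) * c (τ k ω) (s₀ + 1) ω) atTop = 0 := by
    filter_upwards [hCfin, ae_all_iff.2 hCb] with ω hω hb
    have h1 : Tendsto (fun k => ENNReal.ofReal (ρ k ω) * (C ω + 1)) atTop (𝓝 0) := by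
      have := ENNReal.Tendsto.mul_const (b := C ω + 1)
        (ENNReal.tendsto_ofReal (hρlim ω)) (Or.inr (by simp [hω.ne]))
      simpa using this
    refine (tendsto_of_tendsto_of_tendsto_of_le_of_le tendsto_const_nhds h1
      (fun _ => zero_le) fun k => ?_).liminf_eq
    simp only [hl₂def]
    rw [ENNReal.ofReal_mul (hρ0 k ω).le, mul_assoc]
    gcongr
    refine (hb k).trans ?_
    gcongr
    simp
  obtain ⟨κ, hκ, hκk, hκf⟩ := exists_measurable_index_le_liminf hf
  obtain ⟨κ', hκ', hκk', y, hy, hylim⟩ := exists_measurable_index_tendsto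
    (m := 𝓖 (s₀ + 1)) (v := fun k ω => l₂ (κ k ω) ω • X (τ (κ k ω) ω) s₀ ω)
    (fun k => (measurable_apply_index hl₂ (hκ k)).smul
      (measurable_apply_index (fun i => hX i s₀) (measurable_apply_index hτ (hκ k))))
    (fun ω => ⟨1, fun k => by
      have h1 : l₂ (κ k ω) ω • X (τ (κ k ω) ω) s₀ ω = ρ (κ k ω) ω • v (κ k ω) ω := by
        simp only [hl₂def, hvdef, mul_smul]
      rw [h1, norm_smul, Real.norm_of_nonneg (hρ0 _ _).le]
      nlinarith [hρv (κ k ω) ω, hρ0 (κ k ω) ω]⟩)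
  set κ₂ : ℕ → Ω → ℕ := fun k ω => κ (κ' k ω) ω with hκ₂def
  have hκ₂ : ∀ k, Measurable[𝓖 (s₀ + 1)] (κ₂ k) := fun k => measurable_apply_index hκ (hκ' k)
  have hκ₂lim : ∀ ω, Tendsto (fun k => κ₂ k ω) atTop atTop := fun ω =>
    tendsto_atTop_mono (fun k => (hκk' k ω).trans (hκk _ ω)) tendsto_id
  obtain ⟨w, D, hw, hwz, hD, hDint, hlim⟩ := ih (fun k ω => l₂ (κ₂ k ω) ω)
    (fun k ω => τ (κ₂ k ω) ω) (Function.update (fun _ _ => 0) s₀ y) (fun _ => 0)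
    (fun k => measurable_apply_index hl₂ (hκ₂ k)) (fun k => measurable_apply_index hτ (hκ₂ k))
    (fun k ω => mul_pos (hρ0 _ _) (hl0 _ _))
    (fun k ω => mul_le_one₀ (hρ1 _ _) (hl0 _ _).le (hl1 _ _))
    (fun s => by
      by_cases hs : s = s₀
      · subst hs; simpa using hy
      · rw [Function.update_of_ne hs]; exact measurable_const)
    (by
      filter_upwards [hconv] with ω hω s hs
      by_cases hs' : s = s₀
      · subst hs'; simpa using hylim ω
      · rw [Function.update_of_ne hs']
        have hlt : s < s₀ := lt_of_le_of_ne (Nat.lt_succ_iff.1 hs) hs'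
        have h1 := ((hρlim ω).smul (hω s hlt)).comp (hκ₂lim ω)
        simpa [hl₂def, mul_smul, Function.comp_def] using h1)
    measurable_const (by simp)
    (fun k => by
      filter_upwards [hfliminf] with ω hω
      refine (hκf (κ' k ω) ω).trans ?_
      rw [hω]
      gcongr
      exact hκk' k ω)
  have hws : w s₀ = y := by simpa using hwz s₀ (Nat.lt_succ_self _)
  have hD0 : ∀ᵐ ω ∂μ, D ω = 0 := by
    have h1 := hDint univ MeasurableSet.univ
    simp only [Measure.restrict_univ, lintegral_const, zero_mul, nonpos_iff_eq_zero] at h1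
    exact (lintegral_eq_zero_iff hD).1 h1
  have hall := ae_all_iff.2 (hred w hw
    (fun r hr => by
      rw [hwz r (Nat.lt_succ_of_lt hr), Function.update_of_ne hr.ne]
      rfl)
    (by
      filter_upwards [hlim, hD0] with ω ⟨κ₃, hκ₃, hκw, hκD⟩ hDω
      refine ⟨fun k => l₂ (κ₂ (κ₃ k) ω) ω, fun k => τ (κ₂ (κ₃ k) ω) ω,
        fun k => mul_pos (hρ0 _ _) (hl0 _ _), (hl₂lim ω).comp ((hκ₂lim ω).comp hκ₃), hκw,
        fun k => ?_⟩
      simpa [hDω] using hκD k))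
  filter_upwards [hall] with ω hω
  by_contra hcon
  have hωB : ω ∈ B := not_lt_top_iff.1 hcon
  have hlimw : Tendsto (fun k => l₂ (κ₂ k ω) ω • X (τ (κ₂ k ω) ω) s₀ ω) atTop (𝓝 (w s₀ ω)) := by
    rw [hws]; exact hylim ω
  have hnorm : ∀ k, ‖l₂ k ω • X (τ k ω) s₀ ω‖ = 1 - ρ k ω := fun k => by
    have h1 : l₂ k ω • X (τ k ω) s₀ ω = ρ k ω • v k ω := by
      simp only [hl₂def, hvdef, mul_smul]
    have h2 : ρ k ω * (1 + ‖v k ω‖) = 1 := by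
      simp only [hρdef, hωB, if_true]
      exact div_mul_cancel₀ _ (by positivity)
    rw [h1, norm_smul, Real.norm_of_nonneg (hρ0 _ _).le]
    linarith
  have hw1 : ‖w s₀ ω‖ = 1 := by
    refine tendsto_nhds_unique hlimw.norm ?_
    simp only [hnorm]
    simpa using (tendsto_const_nhds (x := (1 : ℝ))).sub ((hρlim ω).comp (hκ₂lim ω))
  have hineq : ∀ k, ‖l₂ k ω • X (τ k ω) s₀ ω‖
      ≤ 2 * ‖l₂ k ω • X (τ k ω) s₀ ω - ‖l₂ k ω • X (τ k ω) s₀ ω‖ • w s₀ ω‖ + l₂ k ω := fun k => by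
    have hpos : 0 < l₂ k ω := mul_pos (hρ0 _ _) (hl0 _ _)
    have h1 := mul_le_mul_of_nonneg_left (hω (τ k ω)) hpos.le
    have h2 : l₂ k ω • X (τ k ω) s₀ ω - ‖l₂ k ω • X (τ k ω) s₀ ω‖ • w s₀ ω
        = l₂ k ω • (X (τ k ω) s₀ ω - ‖X (τ k ω) s₀ ω‖ • w s₀ ω) := by
      rw [norm_smul, Real.norm_of_nonneg hpos.le, smul_sub,
        mul_smul (l₂ k ω) ‖X (τ k ω) s₀ ω‖ (w s₀ ω)]
    rw [h2, norm_smul, norm_smul, Real.norm_of_nonneg hpos.le]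
    linarith
  have hfinal := le_of_tendsto_of_tendsto hlimw.norm
    (((hlimw.sub (hlimw.norm.smul_const (w s₀ ω))).norm.const_mul 2).add
      ((hl₂lim ω).comp (hκ₂lim ω))) (Eventually.of_forall fun k => hineq (κ₂ k ω))
  rw [hw1] at hfinal
  simp at hfinal
  linarith

theorem LimitProperty.of_succ [IsProbabilityMeasure μ] (hmono : Monotone 𝓖) (hle : ∀ j, 𝓖 j ≤ m0)
    (hX : ∀ ν (s : Fin (T + 1)), Measurable[𝓖 (s + 1)] (X ν s))
    (hc : ∀ ν j, Measurable[𝓖 j] (c ν j))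
    (hcG : ∀ ν j A, MeasurableSet[𝓖 j] A → ∫⁻ ω in A, c ν j ω ∂μ = ∫⁻ ω in A, G ν ω ∂μ)
    {s₀ : Fin (T + 1)} (hred : NearlyReducedAt μ 𝓖 X G s₀)
    (ih : LimitProperty μ 𝓖 X G c (s₀ + 1)) : LimitProperty μ 𝓖 X G c s₀ := by
  classical
  intro l τ z C hl hτ hl0 hl1 hz hconv hC hCfin hCb
  have hj : 𝓖 s₀ ≤ 𝓖 (s₀ + 1) := hmono (Nat.le_succ _)
  replace hl : ∀ k, Measurable[𝓖 s₀] (l k) ∧ Measurable[𝓖 (s₀ + 1)] (l k) := fun k =>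
    ⟨hl k, (hl k).mono hj le_rfl⟩
  replace hτ : ∀ k, Measurable[𝓖 s₀] (τ k) ∧ Measurable[𝓖 (s₀ + 1)] (τ k) := fun k =>
    ⟨hτ k, (hτ k).mono hj le_rfl⟩
  have hf : ∀ k, Measurable[𝓖 (s₀ + 1)]
      fun ω => ENNReal.ofReal (l k ω) * c (τ k ω) (s₀ + 1) ω := fun k =>
    (hl k).2.ennreal_ofReal.mul (measurable_apply_index (fun i => hc i (s₀ + 1)) (hτ k).2)
  set C' : Ω → ℝ≥0∞ := fun ω =>
    liminf (fun k => ENNReal.ofReal (l k ω) * c (τ k ω) (s₀ + 1) ω) atTop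
  have hC' : Measurable[𝓖 (s₀ + 1)] C' := Measurable.liminf hf
  have hC'int : ∀ A, MeasurableSet[𝓖 s₀] A → ∫⁻ ω in A, C' ω ∂μ ≤ ∫⁻ ω in A, C ω ∂μ := fun A hA =>
    setLIntegral_liminf_le (hle s₀) (a := fun i => c i s₀) (b := fun i => c i (s₀ + 1))
      (l := fun k ω => ENNReal.ofReal (l k ω))
      (fun i => (hc i _).mono (hle _) le_rfl) (fun i => (hc i _).mono (hle _) le_rfl)
      (fun i A hA => (hcG i _ A hA).trans (hcG i _ A (hj A hA)).symm)
      (fun k => (hl k).1.ennreal_ofReal) (fun k => (hτ k).1) hCb hA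
  have hC'fin : ∀ᵐ ω ∂μ, C' ω < ⊤ :=
    ae_lt_top_of_setLIntegral_le (hle s₀) hC (hC'.mono (hle _) le_rfl) hCfin hC'int
  obtain ⟨κ, hκ, hκk, hκf⟩ := exists_measurable_index_le_liminf hf
  have hκlim : ∀ ω, Tendsto (fun k => κ k ω) atTop atTop := fun ω =>
    tendsto_atTop_mono (fun k => hκk k ω) tendsto_id
  set l₁ : ℕ → Ω → ℝ := fun k ω => l (κ k ω) ω with hl₁def
  set τ₁ : ℕ → Ω → ℕ := fun k ω => τ (κ k ω) ω with hτ₁def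
  have hl₁ : ∀ k, Measurable[𝓖 (s₀ + 1)] (l₁ k) := fun k =>
    measurable_apply_index (fun i => (hl i).2) (hκ k)
  have hτ₁ : ∀ k, Measurable[𝓖 (s₀ + 1)] (τ₁ k) := fun k =>
    measurable_apply_index (fun i => (hτ i).2) (hκ k)
  have hconv₁ : ∀ᵐ ω ∂μ, ∀ s : Fin (T + 1), s < s₀ →
      Tendsto (fun k => l₁ k ω • X (τ₁ k ω) s ω) atTop (𝓝 (z s ω)) := by
    filter_upwards [hconv] with ω hω s hs
    exact (hω s hs).comp (hκlim ω)
  have hB := ae_liminf_enorm_lt_top hX hc hred ih hl₁ hτ₁ (fun _ _ => hl0 _ _)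
    (fun _ _ => hl1 _ _) hconv₁ hC'fin (fun k => Eventually.of_forall fun ω => hκf k ω)
  have hv : ∀ k, Measurable[𝓖 (s₀ + 1)] fun ω => l₁ k ω • X (τ₁ k ω) s₀ ω := fun k =>
    (hl₁ k).smul (measurable_apply_index (fun i => hX i s₀) (hτ₁ k))
  obtain ⟨κ₂, hκ₂, hκk₂, hκf₂⟩ := exists_measurable_index_le_liminf
    (m := 𝓖 (s₀ + 1)) (f := fun k ω => ‖l₁ k ω • X (τ₁ k ω) s₀ ω‖ₑ)
    (fun k => measurable_enorm.comp (hv k))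
  set B : Set Ω := {ω | liminf (fun k => ‖l₁ k ω • X (τ₁ k ω) s₀ ω‖ₑ) atTop < ⊤} with hBdef
  have hBm : MeasurableSet[𝓖 (s₀ + 1)] B :=
    (Measurable.liminf fun k => measurable_enorm.comp (hv k)) measurableSet_Iio
  obtain ⟨κ₃, hκ₃, hκk₃, y, hy, hylim⟩ := exists_measurable_index_tendsto
    (m := 𝓖 (s₀ + 1))
    (v := fun k => B.indicator fun ω => l₁ (κ₂ k ω) ω • X (τ₁ (κ₂ k ω) ω) s₀ ω)
    (fun k => (measurable_apply_index hv (hκ₂ k)).indicator hBm)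
    (fun ω => by
      by_cases hω : ω ∈ B
      · refine ⟨(liminf (fun k => ‖l₁ k ω • X (τ₁ k ω) s₀ ω‖ₑ) atTop + 1).toReal, fun k => ?_⟩
        rw [Set.indicator_of_mem hω, ← toReal_enorm]
        refine ENNReal.toReal_mono (by simpa using (show _ < _ from hω).ne) ((hκf₂ k ω).trans ?_)
        gcongr
        simp
      · exact ⟨0, fun k => by simp [hω]⟩)
  set κ₄ : ℕ → Ω → ℕ := fun k ω => κ₂ (κ₃ k ω) ω with hκ₄def
  have hκ₄ : ∀ k, Measurable[𝓖 (s₀ + 1)] (κ₄ k) := fun k => measurable_apply_index hκ₂ (hκ₃ k)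
  have hκk₄ : ∀ k ω, k ≤ κ₄ k ω := fun k ω => (hκk₃ k ω).trans (hκk₂ _ ω)
  have hκ₄lim : ∀ ω, Tendsto (fun k => κ₄ k ω) atTop atTop := fun ω =>
    tendsto_atTop_mono (fun k => hκk₄ k ω) tendsto_id
  obtain ⟨z', D, hz', hz'z, hD, hDint, hlim⟩ := ih (fun k ω => l₁ (κ₄ k ω) ω)
    (fun k ω => τ₁ (κ₄ k ω) ω) (Function.update z s₀ y) C'
    (fun k => measurable_apply_index hl₁ (hκ₄ k)) (fun k => measurable_apply_index hτ₁ (hκ₄ k))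
    (fun k ω => hl0 _ _) (fun k ω => hl1 _ _)
    (fun s => by
      by_cases hs : s = s₀
      · subst hs; simpa using hy
      · rw [Function.update_of_ne hs]; exact hz s)
    (by
      filter_upwards [hconv₁, hB] with ω hω hBω s hs
      by_cases hs' : s = s₀
      · subst hs'
        have h1 := hylim ω
        simp only [Set.indicator_of_mem (show ω ∈ B from hBω)] at h1
        simpa using h1
      · rw [Function.update_of_ne hs']
        exact (hω s (lt_of_le_of_ne (Nat.lt_succ_iff.1 hs) hs')).comp (hκ₄lim ω))
    hC' hC'fin
    (fun k => Eventually.of_forall fun ω => by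
      refine (hκf (κ₄ k ω) ω).trans ?_
      gcongr
      exact hκk₄ k ω)
  refine ⟨z', D, hz', fun s hs => ?_, hD, fun A hA => (hDint A (hj A hA)).trans (hC'int A hA), ?_⟩
  · rw [hz'z s (Nat.lt_succ_of_lt hs), Function.update_of_ne]
    rintro rfl
    exact lt_irrefl _ hs
  · filter_upwards [hlim] with ω ⟨κ₅, hκ₅, h1, h2⟩
    exact ⟨fun k => κ (κ₄ (κ₅ k) ω) ω, (hκlim ω).comp ((hκ₄lim ω).comp hκ₅), h1, h2⟩

/-- A sequence of adapted strategies that is nearly reduced at all times has an adapted pointwise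
subsequential limit whose cost is at most the limiting expected cost. -/
theorem exists_adapted_limit [IsProbabilityMeasure μ] (hmono : Monotone 𝓖) (hle : ∀ j, 𝓖 j ≤ m0)
    (hX : ∀ ν (s : Fin (T + 1)), Measurable[𝓖 (s + 1)] (X ν s))
    (hG : ∀ ν, Measurable (G ν)) (hred : ∀ s, NearlyReducedAt μ 𝓖 X G s)
    (hbot : 𝓖 0 = ⊥) {I : ℝ≥0∞} (hI : I < ⊤)
    (hGI : ∀ ν : ℕ, ∫⁻ ω, G ν ω ∂μ ≤ I + ((ν : ℝ≥0∞) + 1)⁻¹) :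
    ∃ (z : (s : Fin (T + 1)) → Ω → Fin (n s) → ℝ) (D : Ω → ℝ≥0∞),
      (∀ s : Fin (T + 1), Measurable[𝓖 (s + 1)] (z s)) ∧ ∫⁻ ω, D ω ∂μ ≤ I ∧
      ∀ᵐ ω ∂μ, ∃ κ : ℕ → ℕ,
        (∀ s, Tendsto (fun k => X (κ k) s ω) atTop (𝓝 (z s ω))) ∧
        ∀ k, G (κ k) ω ≤ D ω + ((k : ℝ≥0∞) + 1)⁻¹ := by
  set c : ℕ → ℕ → Ω → ℝ≥0∞ := fun ν j => condLExp (𝓖 j) μ (G ν) with hcdef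
  have hc : ∀ ν j, Measurable[𝓖 j] (c ν j) := fun ν j => measurable_condLExp _ _ _
  have hcG : ∀ ν j A, MeasurableSet[𝓖 j] A → ∫⁻ ω in A, c ν j ω ∂μ = ∫⁻ ω in A, G ν ω ∂μ :=
    fun ν j A hA => setLIntegral_condLExp (hle j) _ _ hA
  have hlp : LimitProperty μ 𝓖 X G c 0 := by
    refine Nat.decreasingInduction' (n := T + 1) (P := LimitProperty μ 𝓖 X G c)
      (fun j hj _ ih => ?_) (Nat.zero_le _) (limitProperty_horizon hle hG hc hcG)
    exact LimitProperty.of_succ hmono hle hX hc hcG (s₀ := ⟨j, hj⟩) (hred _) ih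
  obtain ⟨z, D, hz, -, -, hD, hlim⟩ := hlp (fun _ _ => 1) (fun k _ => k) (fun _ _ => 0) (fun _ => I)
    (fun _ => measurable_const) (fun _ => measurable_const) (fun _ _ => one_pos)
    (fun _ _ => le_rfl) (fun _ => measurable_const) (by simp) measurable_const (by simp [hI])
    (fun k => Eventually.of_forall fun ω => by
      have h1 : Measurable[⊥] (c k 0) := hbot ▸ hc k 0
      obtain ⟨a, ha⟩ := stronglyMeasurable_bot_iff.1 h1.stronglyMeasurable
      have h2 := hcG k 0 univ MeasurableSet.univ
      simp only [ha, Measure.restrict_univ, lintegral_const, measure_univ, mul_one] at h2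
      simpa [ha, h2] using hGI k)
  refine ⟨z, D, hz, ?_, ?_⟩
  · simpa using hD univ MeasurableSet.univ
  · filter_upwards [hlim] with ω ⟨κ, _, h1, h2⟩
    exact ⟨κ, by simpa using h1, by simpa using h2⟩

end AdaptedLimit

section Reduction

theorem exists_forall_ae_le_two_mul {Ω ι : Type*} [Nonempty ι] {m : MeasurableSpace Ω}
    {μ : Measure Ω} [IsProbabilityMeasure μ] {φ : ι → Ω → ℝ≥0∞} (hφ : ∀ q, Measurable (φ q))
    (hpos : ∀ q ω, 0 < φ q ω) (hone : ∀ q ω, φ q ω ≤ 1)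
    (hglue : ∀ (q : ℕ → ι) (τ : Ω → ℕ), Measurable τ → ∃ p, ∀ ω, φ p ω = φ (q (τ ω)) ω) :
    ∃ w, ∀ q, ∀ᵐ ω ∂μ, φ q ω ≤ 2 * φ w ω := by
  classical
  set S : ℝ≥0∞ := ⨆ q, ∫⁻ ω, φ q ω ∂μ
  have hint : ∀ q, ∫⁻ ω, φ q ω ∂μ ≤ 1 := fun q =>
    (lintegral_mono (hone q)).trans (by simp)
  have hSfin : S ≠ ⊤ := ((iSup_le hint).trans_lt ENNReal.one_lt_top).ne
  have hex : ∀ k : ℕ, ∃ q, S ≤ ∫⁻ ω, φ q ω ∂μ + ((k : ℝ≥0∞) + 1)⁻¹ := by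
    intro k
    by_contra! hcon
    obtain ⟨q₀⟩ := ‹Nonempty ι›
    have hε : ((k : ℝ≥0∞) + 1)⁻¹ ≠ 0 := by simp
    have hle : S ≤ S - ((k : ℝ≥0∞) + 1)⁻¹ :=
      iSup_le fun q => ENNReal.le_sub_of_add_le_right (by simp) (hcon q).le
    have hS0 : S ≠ 0 := (bot_lt_of_lt (hcon q₀)).ne'
    exact (ENNReal.sub_lt_self hSfin hS0 hε).not_ge hle
  choose q hq using hex
  have hRtop : ∀ ω, ⨆ k, φ (q k) ω ≤ 1 := fun ω => iSup_le fun k => hone _ ω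
  have hτ : ∀ ω, ∃ k, ⨆ i, φ (q i) ω < 2 * φ (q k) ω := by
    intro ω
    by_contra! hcon
    have hR0 : ⨆ i, φ (q i) ω ≠ 0 :=
      ((hpos (q 0) ω).trans_le (le_iSup (fun i => φ (q i) ω) 0)).ne'
    have h2 : 2 * ⨆ i, φ (q i) ω ≤ ⨆ i, φ (q i) ω := by
      rw [ENNReal.mul_iSup]
      exact iSup_le hcon
    rw [two_mul] at h2
    have hRfin : ⨆ i, φ (q i) ω ≠ ⊤ := ((hRtop ω).trans_lt ENNReal.one_lt_top).ne
    exact (ENNReal.lt_add_right hRfin hR0).not_ge h2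
  obtain ⟨w, hw⟩ := hglue q (fun ω => Nat.find (hτ ω)) (measurable_find hτ fun k =>
    measurableSet_lt (Measurable.iSup fun i => hφ (q i)) ((hφ (q k)).const_mul 2))
  refine ⟨w, fun p => ?_⟩
  have hsub : ∀ k : ℕ, ∫⁻ ω, (φ p ω - ⨆ i, φ (q i) ω) ∂μ ≤ ((k : ℝ≥0∞) + 1)⁻¹ := by
    intro k
    obtain ⟨r, hr⟩ := hglue (fun i => if i = 0 then p else q k)
      (fun ω => if φ (q k) ω ≤ φ p ω then 0 else 1)
      (Measurable.ite (measurableSet_le (hφ _) (hφ _)) measurable_const measurable_const)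
    have hmax : ∀ ω, φ r ω = φ p ω - φ (q k) ω + φ (q k) ω := by
      intro ω
      rw [hr ω, tsub_add_eq_max]
      by_cases hle : φ (q k) ω ≤ φ p ω
      · simp [hle]
      · simp [hle, (not_le.1 hle).le]
    have h1 : ∫⁻ ω, (φ p ω - φ (q k) ω) ∂μ + ∫⁻ ω, φ (q k) ω ∂μ
        ≤ ((k : ℝ≥0∞) + 1)⁻¹ + ∫⁻ ω, φ (q k) ω ∂μ := by
      rw [← lintegral_add_right _ (hφ _), ← lintegral_congr hmax, add_comm _ (lintegral _ _)]
      exact (le_iSup (fun q => ∫⁻ ω, φ q ω ∂μ) r).trans (hq k)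
    refine (lintegral_mono fun ω => ?_).trans
      ((ENNReal.add_le_add_iff_right ((hint (q k)).trans_lt ENNReal.one_lt_top).ne).1 h1)
    exact tsub_le_tsub_left (le_iSup (fun i => φ (q i) ω) k) _
  have hzero : ∫⁻ ω, (φ p ω - ⨆ i, φ (q i) ω) ∂μ = 0 := by
    have hlim : Tendsto (fun k : ℕ => ((k : ℝ≥0∞) + 1)⁻¹) atTop (𝓝 0) := by
      simpa using (tendsto_add_atTop_iff_nat 1).2 ENNReal.tendsto_inv_nat_nhds_zero
    exact le_antisymm (ge_of_tendsto' hlim hsub) zero_le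
  filter_upwards [(lintegral_eq_zero_iff
    ((hφ p).sub (Measurable.iSup fun i => hφ (q i)))).1 hzero] with ω hω
  rw [hw ω]
  exact (tsub_eq_zero_iff_le.1 hω).trans (Nat.find_spec (hτ ω)).le

variable {Ω : Type*} {m0 : MeasurableSpace Ω} {μ : Measure Ω} {T : ℕ} {n : Fin (T + 1) → ℕ}
  {F : Fin (T + 1) → MeasurableSpace Ω} {Nhat : Ω → Submodule ℝ (Strat T n)}

/-- Adapted strategies that take values in the subspaces `Nhat` and vanish before time `s`. -/
def IsNullStrategy (μ : Measure Ω) (F : Fin (T + 1) → MeasurableSpace Ω)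
    (Nhat : Ω → Submodule ℝ (Strat T n)) (s : Fin (T + 1))
    (q : (r : Fin (T + 1)) → Ω → Fin (n r) → ℝ) : Prop :=
  (∀ r, Measurable[F r] (q r)) ∧ (∀ r, r < s → q r = 0) ∧ ∀ᵐ ω ∂μ, (fun r => q r ω) ∈ Nhat ω

theorem IsNullStrategy.add {s : Fin (T + 1)} {p q : (r : Fin (T + 1)) → Ω → Fin (n r) → ℝ}
    (hp : IsNullStrategy μ F Nhat s p) (hq : IsNullStrategy μ F Nhat s q) :
    IsNullStrategy μ F Nhat s (p + q) := by
  refine ⟨fun r => (hp.1 r).add (hq.1 r), fun r hr => ?_, ?_⟩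
  · simp [hp.2.1 r hr, hq.2.1 r hr]
  · filter_upwards [hp.2.2, hq.2.2] with ω h1 h2
    exact (Nhat ω).add_mem h1 h2

theorem IsNullStrategy.smul (hF : Monotone F) {s : Fin (T + 1)}
    {q : (r : Fin (T + 1)) → Ω → Fin (n r) → ℝ} (hq : IsNullStrategy μ F Nhat s q)
    {a : Ω → ℝ} (ha : Measurable[F s] a) :
    IsNullStrategy μ F Nhat s (fun r ω => a ω • q r ω) := by
  refine ⟨fun r => ?_, fun r hr => ?_, ?_⟩
  · by_cases hr : r < s
    · simp only [hq.2.1 r hr, Pi.zero_apply, smul_zero]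
      exact measurable_const
    · exact (ha.mono (hF (not_lt.1 hr)) le_rfl).smul (hq.1 r)
  · funext ω
    simp [hq.2.1 r hr]
  · filter_upwards [hq.2.2] with ω h1
    exact (Nhat ω).smul_mem (a ω) h1

theorem IsNullStrategy.apply_index (hF : Monotone F) {s : Fin (T + 1)}
    {q : ℕ → (r : Fin (T + 1)) → Ω → Fin (n r) → ℝ} (hq : ∀ k, IsNullStrategy μ F Nhat s (q k))
    {τ : Ω → ℕ} (hτ : Measurable[F s] τ) :
    IsNullStrategy μ F Nhat s (fun r ω => q (τ ω) r ω) := by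
  refine ⟨fun r => ?_, fun r hr => ?_, ?_⟩
  · by_cases hr : r < s
    · simp only [(hq _).2.1 r hr]
      exact measurable_const
    · exact measurable_apply_index (f := fun k => q k r) (fun k => (hq k).1 r)
        (hτ.mono (hF (not_lt.1 hr)) le_rfl)
  · funext ω
    simp [(hq (τ ω)).2.1 r hr]
  · filter_upwards [ae_all_iff.2 fun k => (hq k).2.2] with ω h1
    exact h1 (τ ω)

theorem exists_isNullStrategy_norm_sub_le [IsProbabilityMeasure μ] (hF : Monotone F)
    (hFle : ∀ t, F t ≤ m0) (s : Fin (T + 1)) {x : Ω → Fin (n s) → ℝ} (hx : Measurable[F s] x) :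
    ∃ w, IsNullStrategy μ F Nhat s w ∧ ∀ q, IsNullStrategy μ F Nhat s q →
      ∀ᵐ ω ∂μ, ‖x ω - w s ω‖ ≤ 2 * ‖x ω - q s ω‖ + 1 := by
  have hzero : IsNullStrategy μ F Nhat s 0 :=
    ⟨fun r => measurable_const, fun r _ => rfl, ae_of_all _ fun ω => (Nhat ω).zero_mem⟩
  have : Nonempty {q // IsNullStrategy μ F Nhat s q} := ⟨⟨0, hzero⟩⟩
  have : IsProbabilityMeasure (μ.trim (hFle s)) :=
    ⟨by rw [trim_measurableSet_eq (hFle s) MeasurableSet.univ, measure_univ]⟩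
  have hpos : ∀ v : Fin (n s) → ℝ, 0 < 1 + ‖v‖ := fun v => by positivity
  obtain ⟨⟨w, hw⟩, hmax⟩ := @exists_forall_ae_le_two_mul Ω {q // IsNullStrategy μ F Nhat s q} _
    (F s) (μ.trim (hFle s)) _ (fun q ω => ENNReal.ofReal (1 + ‖x ω - q.1 s ω‖)⁻¹)
    (fun q => ENNReal.measurable_ofReal.comp (measurable_inv.comp
      (measurable_const.add (measurable_norm.comp (hx.sub (q.2.1 s))))))
    (fun q ω => ENNReal.ofReal_pos.2 (inv_pos.2 (hpos _)))
    (fun q ω => ENNReal.ofReal_le_one.2 (inv_le_one_of_one_le₀ (by simp)))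
    (fun q τ hτ => ⟨⟨_, IsNullStrategy.apply_index hF (fun k => (q k).2) hτ⟩, fun ω => rfl⟩)
  refine ⟨w, hw, fun q hq => ?_⟩
  filter_upwards [ae_of_ae_trim (hFle s) (hmax ⟨q, hq⟩)] with ω hω
  have h2 : (2 : ℝ≥0∞) = ENNReal.ofReal 2 := by simp
  rw [h2, ← ENNReal.ofReal_mul zero_le_two, ENNReal.ofReal_le_ofReal_iff (by positivity),
    ← div_eq_mul_inv, inv_eq_one_div, div_le_div_iff₀ (hpos _) (hpos _)] at hω
  linarith

theorem exists_reduced [IsProbabilityMeasure μ] (hF : Monotone F) (hFle : ∀ t, F t ≤ m0)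
    {x : (r : Fin (T + 1)) → Ω → Fin (n r) → ℝ} (hx : ∀ r, Measurable[F r] (x r)) :
    ∃ w, IsNullStrategy μ F Nhat 0 w ∧ ∀ s q, IsNullStrategy μ F Nhat s q →
      ∀ᵐ ω ∂μ, ‖x s ω + w s ω‖ ≤ 2 * ‖x s ω + w s ω - q s ω‖ + 1 := by
  suffices H : ∀ j : ℕ, ∃ w, IsNullStrategy μ F Nhat 0 w ∧ ∀ s : Fin (T + 1), (s : ℕ) < j →
      ∀ q, IsNullStrategy μ F Nhat s q →
      ∀ᵐ ω ∂μ, ‖x s ω + w s ω‖ ≤ 2 * ‖x s ω + w s ω - q s ω‖ + 1 by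
    obtain ⟨w, hw, h⟩ := H (T + 1)
    exact ⟨w, hw, fun s => h s s.2⟩
  intro j
  induction j with
  | zero =>
    exact ⟨0, ⟨fun r => measurable_const, fun r _ => rfl,
      ae_of_all _ fun ω => (Nhat ω).zero_mem⟩, fun s hs => absurd hs (Nat.not_lt_zero _)⟩
  | succ j ih =>
    obtain ⟨w, hw, hmin⟩ := ih
    by_cases hj : j < T + 1
    · set t : Fin (T + 1) := ⟨j, hj⟩
      obtain ⟨p, hp, hpmin⟩ := exists_isNullStrategy_norm_sub_le (μ := μ) (Nhat := Nhat) hF hFle t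
        ((hx t).add (hw.1 t))
      have hp0 : IsNullStrategy μ F Nhat 0 p :=
        ⟨hp.1, fun r hr => absurd hr (Fin.not_lt_zero r), hp.2.2⟩
      have hneg := hp0.smul hF (a := fun _ => -1) measurable_const
      refine ⟨_, hw.add hneg, fun s hs q hq => ?_⟩
      rcases (Nat.lt_succ_iff_lt_or_eq.1 hs) with hlt | heq
      · have hps : p s = 0 := hp.2.1 s hlt
        simpa [hps] using hmin s hlt q hq
      · obtain rfl : s = t := Fin.ext heq
        filter_upwards [hpmin (p + q) (hp.add hq)] with ω hω
        simp only [Pi.add_apply] at hω ⊢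
        have e1 : x t ω + (w t ω + (-1 : ℝ) • p t ω) = x t ω + w t ω - p t ω := by module
        rw [e1, sub_sub]
        exact hω
    · exact ⟨w, hw, fun s _ => hmin s (by omega)⟩

end Reduction

section Integrand

theorem hor_le_zero_of_tendsto {E : Type*} [SeminormedAddCommGroup E] [NormedSpace ℝ E]
    {g : E → EReal} {m : ℝ} (hbd : ∀ x, (m : EReal) ≤ g x) {l : ℕ → ℝ} {y : ℕ → E} {w : E}
    (hl0 : ∀ k, 0 < l k) (hl : Tendsto l atTop (𝓝 0))
    (hy : Tendsto (fun k => l k • y k) atTop (𝓝 w))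
    (hb : ∀ k : ℕ, ENNReal.ofReal (l k) * (g (y k) - m).toENNReal ≤ ((k : ℝ≥0∞) + 1)⁻¹) :
    hor g w ≤ 0 := by
  have hval : ∀ k : ℕ, (l k : EReal) * g (y k) ≤ ((1 / ((k : ℝ) + 1) + l k * m : ℝ) : EReal) := by
    intro k
    have hbk := hb k
    have hgbot : g (y k) ≠ ⊥ := ne_bot_of_le_ne_bot (EReal.coe_ne_bot m) (hbd (y k))
    have hinv : ((k : ℝ≥0∞) + 1)⁻¹ = ENNReal.ofReal (1 / ((k : ℝ) + 1)) := by
      rw [one_div, ENNReal.ofReal_inv_of_pos (by positivity),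
        ENNReal.ofReal_add (by positivity) zero_le_one]
      simp
    have hgtop : g (y k) ≠ ⊤ := by
      intro htop
      rw [htop, EReal.top_sub_coe, EReal.toENNReal_top,
        ENNReal.mul_top (ENNReal.ofReal_pos.2 (hl0 k)).ne', hinv] at hbk
      exact ENNReal.ofReal_ne_top (top_le_iff.1 hbk)
    lift g (y k) to ℝ using ⟨hgtop, hgbot⟩ with a ha
    rw [← EReal.coe_sub, EReal.real_coe_toENNReal, ← ENNReal.ofReal_mul (hl0 k).le, hinv,
      ENNReal.ofReal_le_ofReal_iff (by positivity)] at hbk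
    rw [← EReal.coe_mul, EReal.coe_le_coe_iff]
    linarith
  have hlim : Tendsto (fun k : ℕ => ((1 / ((k : ℝ) + 1) + l k * m : ℝ) : EReal)) atTop (𝓝 0) := by
    have := tendsto_one_div_add_atTop_nhds_zero_nat (𝕜 := ℝ) |>.add (hl.mul_const m)
    rw [zero_mul, add_zero] at this
    exact (continuous_coe_real_ereal.tendsto 0).comp this
  refine iSup₂_le fun δ hδ => ge_of_tendsto hlim ?_
  filter_upwards [hl.eventually_lt_const hδ, hy.eventually (closedBall_mem_nhds w hδ)]
    with k hk hyk
  refine (iInf₂_le (l k) ⟨hl0 k, hk⟩).trans ((iInf₂_le (l k • y k) hyk).trans ?_)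
  rw [inv_smul_smul₀ (hl0 k).ne']
  exact hval k

theorem LowerSemicontinuous.le_of_tendsto_of_le_add {E : Type*} [TopologicalSpace E]
    {u : E → ℝ≥0∞} (hu : LowerSemicontinuous u) {y : ℕ → E} {z : E} {d : ℝ≥0∞}
    (hy : Tendsto y atTop (𝓝 z)) (hd : ∀ k : ℕ, u (y k) ≤ d + ((k : ℝ≥0∞) + 1)⁻¹) : u z ≤ d := by
  have hlim : Tendsto (fun k : ℕ => d + ((k : ℝ≥0∞) + 1)⁻¹) atTop (𝓝 (d + 0)) := by
    refine tendsto_const_nhds.add ?_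
    simpa using (tendsto_add_atTop_iff_nat 1).2 ENNReal.tendsto_inv_nat_nhds_zero
  rw [add_zero] at hlim
  exact le_of_forall_lt_imp_le_of_dense fun c hc => ge_of_tendsto hlim
    ((hy.eventually (hu z c hc)).mono fun k hk => hk.le.trans (hd k))

theorem continuous_toENNReal_sub_coe (r : ℝ) :
    Continuous fun a : EReal => (a - (r : EReal)).toENNReal := by
  refine EReal.continuous_toENNReal.comp (continuous_iff_continuousAt.2 fun a => ?_)
  simp only [sub_eq_add_neg, ← EReal.coe_neg]
  exact ContinuousAt.comp (f := fun a : EReal => (a, ((-r : ℝ) : EReal)))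
    (EReal.continuousAt_add (Or.inr (EReal.coe_ne_bot _)) (Or.inr (EReal.coe_ne_top _)))
    (by fun_prop)

theorem ePos_eq_toENNReal (x : EReal) : ePos x = x.toENNReal := rfl

theorem eInt_eq_lintegral_add_integral {Ω : Type*} [MeasurableSpace Ω] {μ : Measure Ω}
    {f : Ω → EReal} {m : Ω → ℝ} (hf : Measurable f) (hmeas : Measurable m) (hm : Integrable m μ)
    (hbd : ∀ ω, (m ω : EReal) ≤ f ω) :
    eInt μ f = ((∫⁻ ω, (f ω - m ω).toENNReal ∂μ : ℝ≥0∞) : EReal) + ((∫ ω, m ω ∂μ : ℝ) : EReal) := by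
  have hpt : ∀ ω, (f ω).toENNReal + ENNReal.ofReal (-m ω)
      = (f ω - m ω).toENNReal + (ENNReal.ofReal (m ω) + (-f ω).toENNReal) := by
    intro ω
    have hbot : f ω ≠ ⊥ := ne_bot_of_le_ne_bot (EReal.coe_ne_bot _) (hbd ω)
    by_cases htop : f ω = ⊤
    · simp [htop]
    have hb := hbd ω
    lift f ω to ℝ using ⟨htop, hbot⟩ with a
    rw [EReal.coe_le_coe_iff] at hb
    rw [← EReal.coe_sub, ← EReal.coe_neg]
    simp only [EReal.real_coe_toENNReal]
    rw [← ENNReal.toReal_eq_toReal_iff' (by simp) (by simp)]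
    rw [ENNReal.toReal_add (by simp) (by simp), ENNReal.toReal_add (by simp) (by simp),
      ENNReal.toReal_add (by simp) (by simp)]
    simp only [ENNReal.toReal_ofReal']
    rw [max_eq_left (sub_nonneg.2 hb)]
    have h1 := max_zero_sub_max_neg_zero_eq_self a
    have h2 := max_zero_sub_max_neg_zero_eq_self (m ω)
    linarith
  have hM : ∫⁻ ω, ENNReal.ofReal (m ω) ∂μ ≠ ⊤ := hm.lintegral_lt_top.ne
  have hM' : ∫⁻ ω, ENNReal.ofReal (-m ω) ∂μ ≠ ⊤ := hm.neg.lintegral_lt_top.ne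
  have hN : ∫⁻ ω, (-f ω).toENNReal ∂μ ≠ ⊤ := by
    refine ne_top_of_le_ne_top hM' (lintegral_mono fun ω => ?_)
    rw [← EReal.real_coe_toENNReal, EReal.coe_neg]
    exact EReal.toENNReal_le_toENNReal (EReal.neg_le_neg_iff.2 (hbd ω))
  have hint := lintegral_congr (μ := μ) hpt
  have hright : Measurable fun ω => ENNReal.ofReal (m ω) + (-f ω).toENNReal :=
    hmeas.ennreal_ofReal.add hf.neg.ereal_toENNReal
  rw [lintegral_add_left hf.ereal_toENNReal, lintegral_add_right _ hright,
    lintegral_add_left hmeas.ennreal_ofReal] at hint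
  rw [integral_eq_lintegral_pos_part_sub_lintegral_neg_part hm]
  simp only [eInt, ePos_eq_toENNReal]
  by_cases hg : ∫⁻ ω, (f ω - m ω).toENNReal ∂μ = ⊤
  · rw [hg, top_add, ENNReal.add_eq_top, or_iff_left hM'] at hint
    rw [hg, hint]
    lift ∫⁻ ω, (-f ω).toENNReal ∂μ to NNReal using hN with b
    rfl
  · have hP : ∫⁻ ω, (f ω).toENNReal ∂μ ≠ ⊤ := by
      intro hP
      rw [hP, top_add] at hint
      exact ENNReal.add_ne_top.2 ⟨hg, ENNReal.add_ne_top.2 ⟨hM, hN⟩⟩ hint.symm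
    have hreal := congrArg ENNReal.toReal hint
    rw [ENNReal.toReal_add hP hM', ENNReal.toReal_add hg (ENNReal.add_ne_top.2 ⟨hM, hN⟩),
      ENNReal.toReal_add hM hN] at hreal
    rw [← EReal.coe_ennreal_toReal hP, ← EReal.coe_ennreal_toReal hN,
      ← EReal.coe_ennreal_toReal hg, ← EReal.coe_neg, ← EReal.coe_add, ← EReal.coe_add,
      EReal.coe_eq_coe_iff]
    linarith

theorem eInt_le_eInt_iff {Ω : Type*} [MeasurableSpace Ω] {μ : Measure Ω}
    {f g : Ω → EReal} {m : Ω → ℝ} (hf : Measurable f) (hg : Measurable g) (hmeas : Measurable m)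
    (hm : Integrable m μ) (hfm : ∀ ω, (m ω : EReal) ≤ f ω) (hgm : ∀ ω, (m ω : EReal) ≤ g ω) :
    eInt μ f ≤ eInt μ g ↔
      ∫⁻ ω, (f ω - m ω).toENNReal ∂μ ≤ ∫⁻ ω, (g ω - m ω).toENNReal ∂μ := by
  rw [eInt_eq_lintegral_add_integral hf hmeas hm hfm,
    eInt_eq_lintegral_add_integral hg hmeas hm hgm,
    (EReal.addLECancellable_coe _).add_le_add_iff_right, EReal.coe_ennreal_le_coe_ennreal_iff]

end Integrand

section Minimizer

variable {Ω : Type*} {m0 : MeasurableSpace Ω} {μ : Measure Ω} {T : ℕ} {n : Fin (T + 1) → ℕ}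
  {F : Fin (T + 1) → MeasurableSpace Ω}

/-- The filtration `F`, shifted by one, started at the trivial σ-algebra and continued by the
ambient one. -/
@[reducible]
def shiftedFiltration (m0 : MeasurableSpace Ω) (F : Fin (T + 1) → MeasurableSpace Ω) :
    ℕ → MeasurableSpace Ω
  | 0 => ⊥
  | j + 1 => if hj : j < T + 1 then F ⟨j, hj⟩ else m0

theorem shiftedFiltration_succ (s : Fin (T + 1)) : shiftedFiltration m0 F (s + 1) = F s := by
  rw [shiftedFiltration, dif_pos s.2]

theorem shiftedFiltration_le (hFle : ∀ t, F t ≤ m0) (j : ℕ) : shiftedFiltration m0 F j ≤ m0 := by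
  rcases j with _ | j
  · exact bot_le
  · rw [shiftedFiltration]
    split_ifs
    exacts [hFle _, le_rfl]

theorem monotone_shiftedFiltration (hF : Monotone F) (hFle : ∀ t, F t ≤ m0) :
    Monotone (shiftedFiltration m0 F) := by
  refine monotone_nat_of_le_succ ?_
  rintro (_ | j)
  · exact bot_le
  · by_cases hj : j + 1 < T + 1
    · rw [shiftedFiltration, shiftedFiltration, dif_pos hj, dif_pos (by omega)]
      exact hF (Fin.mk_le_mk.2 (Nat.le_succ j))
    · rw [shiftedFiltration.eq_2 m0 F (j + 1), dif_neg hj]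
      exact shiftedFiltration_le hFle _

theorem exists_adapted_minimizer [IsProbabilityMeasure μ] (hF : Monotone F)
    (hFle : ∀ t, F t ≤ m0) {g : Strat T n → Ω → ℝ≥0∞}
    (hg : ∀ x : (t : Fin (T + 1)) → Ω → Fin (n t) → ℝ, (∀ t, Measurable[F t] (x t)) →
      Measurable fun ω => g (fun t => x t ω) ω)
    (hglsc : ∀ ω, LowerSemicontinuous fun x => g x ω) {p : Ω → Submodule ℝ (Strat T n)}
    (hrec : ∀ (X : ℕ → (t : Fin (T + 1)) → Ω → Fin (n t) → ℝ)
      (w : (t : Fin (T + 1)) → Ω → Fin (n t) → ℝ), (∀ t, Measurable[F t] (w t)) →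
      (∀ᵐ ω ∂μ, IsRecessionDirection X (fun ν ω => g (fun t => X ν t ω) ω) ω (fun t => w t ω)) →
      ∀ᵐ ω ∂μ, (fun t => w t ω) ∈ p ω)
    (hinv : ∀ x w : (t : Fin (T + 1)) → Ω → Fin (n t) → ℝ, (∀ t, Measurable[F t] (x t)) →
      (∀ t, Measurable[F t] (w t)) → (∀ᵐ ω ∂μ, (fun t => w t ω) ∈ p ω) →
      ∫⁻ ω, g (fun t => x t ω + w t ω) ω ∂μ ≤ ∫⁻ ω, g (fun t => x t ω) ω ∂μ) :
    ∃ z : (t : Fin (T + 1)) → Ω → Fin (n t) → ℝ, (∀ t, Measurable[F t] (z t)) ∧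
      ∀ x : (t : Fin (T + 1)) → Ω → Fin (n t) → ℝ, (∀ t, Measurable[F t] (x t)) →
        ∫⁻ ω, g (fun t => z t ω) ω ∂μ ≤ ∫⁻ ω, g (fun t => x t ω) ω ∂μ := by
  set I : ℝ≥0∞ := ⨅ (x : (t : Fin (T + 1)) → Ω → Fin (n t) → ℝ) (_ : ∀ t, Measurable[F t] (x t)),
    ∫⁻ ω, g (fun t => x t ω) ω ∂μ
  have hIle : ∀ x : (t : Fin (T + 1)) → Ω → Fin (n t) → ℝ, (∀ t, Measurable[F t] (x t)) →
      I ≤ ∫⁻ ω, g (fun t => x t ω) ω ∂μ := fun x hx => iInf₂_le x hx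
  rcases eq_top_or_lt_top I with hItop | hIfin
  · exact ⟨0, fun t => measurable_const, fun x hx => by
      rw [top_le_iff.1 (hItop.symm.le.trans (hIle x hx))]
      exact le_top⟩
  have happrox : ∀ ν : ℕ, ∃ x : (t : Fin (T + 1)) → Ω → Fin (n t) → ℝ,
      (∀ t, Measurable[F t] (x t)) ∧
      (∫⁻ ω, g (fun t => x t ω) ω ∂μ ≤ I + ((ν : ℝ≥0∞) + 1)⁻¹) ∧
      ∀ s q, IsNullStrategy μ F p s q →
        ∀ᵐ ω ∂μ, ‖x s ω‖ ≤ 2 * ‖x s ω - q s ω‖ + 1 := by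
    intro ν
    have hlt : I < I + ((ν : ℝ≥0∞) + 1)⁻¹ := ENNReal.lt_add_right hIfin.ne (by simp)
    obtain ⟨x, hlt⟩ := iInf_lt_iff.1 hlt
    obtain ⟨hx, hlt⟩ := iInf_lt_iff.1 hlt
    obtain ⟨w, hw, hred⟩ := exists_reduced (μ := μ) (Nhat := p) hF hFle hx
    have hxw : ∀ t, Measurable[F t] ((x + w) t) := fun t => (hx t).add (hw.1 t)
    exact ⟨x + w, hxw, (hinv x w hx hw.1 hw.2.2).trans hlt.le, hred⟩
  choose X hX hXI hXred using happrox
  obtain ⟨z, D, hz, hD, hlim⟩ := exists_adapted_limit (μ := μ) (X := X)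
    (G := fun ν ω => g (fun t => X ν t ω) ω) (I := I) (monotone_shiftedFiltration hF hFle)
    (shiftedFiltration_le hFle) (fun ν s => by rw [shiftedFiltration_succ]; exact hX ν s)
    (fun ν => hg _ (hX ν))
    (by
      intro s w hw hws hdir ν
      replace hw : ∀ t, Measurable[F t] (w t) := fun t => by
        rw [← shiftedFiltration_succ (m0 := m0) (F := F) t]; exact hw t
      have hnull : IsNullStrategy μ F p s w := ⟨hw, hws, hrec X w hw hdir⟩
      exact hXred ν s (fun r ω => ‖X ν s ω‖ • w r ω)
        (hnull.smul hF (measurable_norm.comp (hX ν s))))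
    rfl hIfin hXI
  replace hz : ∀ t, Measurable[F t] (z t) := fun t => by
    rw [← shiftedFiltration_succ (m0 := m0) (F := F) t]; exact hz t
  refine ⟨z, hz, fun x hx => le_trans ?_ (hIle x hx)⟩
  refine (lintegral_mono_ae ?_).trans hD
  filter_upwards [hlim] with ω hω
  obtain ⟨κ, hκ, hκD⟩ := hω
  exact (hglsc ω).le_of_tendsto_of_le_add (y := fun k => fun t => X (κ k) t ω)
    (tendsto_pi_nhds.2 hκ) hκD

end Minimizer

/-- existence of optimal solutions under the subspace condition on the
set of strategies along which the horizon function of h is nonpositive. -/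
theorem existence_nonconvex
    {Ω : Type*} {m0 : MeasurableSpace Ω} (μ : Measure Ω) [IsProbabilityMeasure μ]
    (hcomp : μ.IsComplete)
    (T : ℕ) (n : Fin (T+1) → ℕ)
    (F : Fin (T+1) → MeasurableSpace Ω)
    (hFmono : ∀ s t : Fin (T+1), s ≤ t → F s ≤ F t) (hFle : ∀ t, F t ≤ m0)
    -- h : an F-normal integrand bounded below by an integrable m
    (h : Strat T n → Ω → EReal)
    (hmeas : Measurable fun p : Strat T n × Ω => h p.1 p.2)
    (hlsc : ∀ ω, LowerSemicontinuous fun x => h x ω)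
    (m : Ω → ℝ) (hm : Integrable m μ) (hbd : ∀ x ω, (m ω : EReal) ≤ h x ω)
    -- N̂ : a measurable set-valued mapping with linear subspace values
    (Nhat : Ω → Set (Strat T n))
    (hNmeas : ∀ O : Set (Strat T n), IsOpen O → MeasurableSet[m0] {ω | (Nhat ω ∩ O).Nonempty})
    (hNsub : ∀ ω, ∃ p : Submodule ℝ (Strat T n), Nhat ω = ↑p)
    -- {x ∈ N : h^∞(x) ≤ 0 a.s.} = {x ∈ N : x ∈ N̂ a.s.}
    (hNset : ∀ x : (t : Fin (T+1)) → Ω → Fin (n t) → ℝ, (∀ t, Measurable[F t] (x t)) →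
      ((∀ᵐ ω ∂μ, hor (fun y => h y ω) (fun s => x s ω) ≤ 0)
        ↔ (∀ᵐ ω ∂μ, (fun s => x s ω) ∈ Nhat ω)))
    -- Eh(x + x') = Eh(x) whenever x' ∈ N̂ a.s.
    (hNinv : ∀ x x' : (t : Fin (T+1)) → Ω → Fin (n t) → ℝ,
      (∀ t, Measurable[F t] (x t)) → (∀ t, Measurable[F t] (x' t)) →
      (∀ᵐ ω ∂μ, (fun s => x' s ω) ∈ Nhat ω) →
      eInt μ (fun ω => h (fun s => x s ω + x' s ω) ω) = eInt μ (fun ω => h (fun s => x s ω) ω)) :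
    -- conclusion: an optimal adapted strategy exists
    ∃ x : (t : Fin (T+1)) → Ω → Fin (n t) → ℝ, (∀ t, Measurable[F t] (x t)) ∧
      eInt μ (fun ω => h (fun t => x t ω) ω)
        = ⨅ (x' : (t : Fin (T+1)) → Ω → Fin (n t) → ℝ)
            (_ : ∀ t, Measurable[F t] (x' t)),
            eInt μ (fun ω => h (fun t => x' t ω) ω) := by
  choose p hp using hNsub
  have hF : Monotone F := fun s t hst => hFmono s t hst
  have hmm : Measurable m :=
    hm.aestronglyMeasurable.aemeasurable.nullMeasurable.measurable_of_complete
  have hadapt : ∀ x : (t : Fin (T + 1)) → Ω → Fin (n t) → ℝ, (∀ t, Measurable[F t] (x t)) →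
      Measurable fun ω => h (fun t => x t ω) ω := fun x hx =>
    hmeas.comp ((measurable_pi_iff.2 fun t => (hx t).mono (hFle t) le_rfl).prodMk measurable_id)
  have hiff : ∀ x y : (t : Fin (T + 1)) → Ω → Fin (n t) → ℝ, (∀ t, Measurable[F t] (x t)) →
      (∀ t, Measurable[F t] (y t)) →
      (eInt μ (fun ω => h (fun t => x t ω) ω) ≤ eInt μ (fun ω => h (fun t => y t ω) ω) ↔
        ∫⁻ ω, (h (fun t => x t ω) ω - m ω).toENNReal ∂μ
          ≤ ∫⁻ ω, (h (fun t => y t ω) ω - m ω).toENNReal ∂μ) := fun x y hx hy =>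
    eInt_le_eInt_iff (hadapt x hx) (hadapt y hy) hmm hm (fun _ => hbd _ _) (fun _ => hbd _ _)
  obtain ⟨z, hz, hmin⟩ := exists_adapted_minimizer (μ := μ) (p := p) hF hFle
    (g := fun x ω => (h x ω - m ω).toENNReal)
    (fun x hx => ((hadapt x hx).sub hmm.coe_real_ereal).ereal_toENNReal)
    (fun ω => (continuous_toENNReal_sub_coe (m ω)).comp_lowerSemicontinuous (hlsc ω) fun a b hab =>
      EReal.toENNReal_le_toENNReal (EReal.sub_le_sub hab le_rfl))
    (fun X w hw hdir => by
      have hhor : ∀ᵐ ω ∂μ, hor (fun y => h y ω) (fun r => w r ω) ≤ 0 := by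
        filter_upwards [hdir] with ω hω
        obtain ⟨l, τ, hl0, hl, hlX, hlG⟩ := hω
        exact hor_le_zero_of_tendsto (m := m ω) (y := fun k => fun t => X (τ k) t ω)
          (fun y => hbd y ω) hl0 hl (tendsto_pi_nhds.2 hlX) hlG
      filter_upwards [(hNset w hw).1 hhor] with ω hω
      rw [hp ω] at hω
      exact hω)
    (fun x w hx hw hwp => (hiff (x + w) x (fun t => (hx t).add (hw t)) hx).1
      (hNinv x w hx hw (hwp.mono fun ω hω => by rw [hp ω]; exact hω)).le)
  exact ⟨z, hz, le_antisymm (le_iInf₂ fun x hx => (hiff z x hz hx).2 (hmin x hx)) (iInf₂_le z hz)⟩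

end
end
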